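/- arXiv:math/0511316 — 5 statements merged into one kernel-verified Lean document; each statement's English description precedes it below -/
import Mathlib

section
/- Let T be a tree on n vertices and let θ_1, θ_2, …, θ_n be the eigenvalues (with multiplicity) of the adjacency matrix of T. Then the number of perfect matchings of the Cartesian product C_4 × T equals ∏_{j=1}^n (2 + θ_j²), where C_4 is the cycle on 4 vertices. -/
open SimpleGraph

/-- The number of perfect matchings of a graph `G`. -/
noncomputable def Pm {V : Type*} (G : SimpleGraph V) : ℕ :=
  Set.ncard {M : G.Subgraph | M.IsPerfectMatching}

namespace PmC4

/-- Coefficient of `x ^ 2` in the local weight. -/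
def a0 (S : Finset (Fin 4)) : ℕ := if S = ∅ then 1 else 0
/-- Coefficient of `x / √2` in the local weight. -/
def a1 (S : Finset (Fin 4)) : ℕ :=
  if S = {0, 1} ∨ S = {1, 2} ∨ S = {2, 3} ∨ S = {3, 0} then 1 else 0
/-- Constant coefficient in the local weight. -/
def a2 (S : Finset (Fin 4)) : ℕ := if S = Finset.univ then 1 else 0

/-- Local weight of a vertex of the tree with parameter `x`, where `S` is the set of levels
used by tree edges at that vertex. -/
noncomputable def wt (x : ℝ) (S : Finset (Fin 4)) : ℝ :=
  a0 S * x ^ 2 + a1 S * (x / √2) + a2 S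

theorem wt_empty (x : ℝ) : wt x ∅ = x ^ 2 := by
  have h0 : a0 ∅ = 1 := by decide
  have h1 : a1 ∅ = 0 := by decide
  have h2 : a2 ∅ = 0 := by decide
  simp [wt, h0, h1, h2]

theorem coeff_ids : ∀ S : Finset (Fin 4),
    (∑ R ∈ Sᶜ.powerset, a0 R * a0 (S ∪ R) = a0 S) ∧
    (∑ R ∈ Sᶜ.powerset, a0 R * a1 (S ∪ R) = a1 S) ∧
    (∑ R ∈ Sᶜ.powerset, a0 R * a2 (S ∪ R) = a2 S) ∧
    (∑ R ∈ Sᶜ.powerset, a1 R * a0 (S ∪ R) = 0) ∧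
    (∑ R ∈ Sᶜ.powerset, a1 R * a1 (S ∪ R) = 4 * a0 S) ∧
    (∑ R ∈ Sᶜ.powerset, a1 R * a2 (S ∪ R) = a1 S) ∧
    (∑ R ∈ Sᶜ.powerset, a2 R * a0 (S ∪ R) = 0) ∧
    (∑ R ∈ Sᶜ.powerset, a2 R * a1 (S ∪ R) = 0) ∧
    (∑ R ∈ Sᶜ.powerset, a2 R * a2 (S ∪ R) = a0 S) := by
  decide +kernel

theorem wt_step (x y : ℝ) (hy : 0 < y) (S : Finset (Fin 4)) :
    ∑ R ∈ Sᶜ.powerset, wt y R * wt x (S ∪ R) = y ^ 2 * wt (x + 1 / y) S := by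
  obtain ⟨h00, h01, h02, h10, h11, h12, h20, h21, h22⟩ := coeff_ids S
  have e : ∀ R : Finset (Fin 4), wt y R * wt x (S ∪ R) =
      ((a0 R * a0 (S ∪ R) : ℕ) : ℝ) * (y ^ 2 * x ^ 2) +
      ((a0 R * a1 (S ∪ R) : ℕ) : ℝ) * (y ^ 2 * (x / √2)) +
      ((a0 R * a2 (S ∪ R) : ℕ) : ℝ) * (y ^ 2) +
      ((a1 R * a0 (S ∪ R) : ℕ) : ℝ) * (y / √2 * x ^ 2) +
      ((a1 R * a1 (S ∪ R) : ℕ) : ℝ) * (y / √2 * (x / √2)) +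
      ((a1 R * a2 (S ∪ R) : ℕ) : ℝ) * (y / √2) +
      ((a2 R * a0 (S ∪ R) : ℕ) : ℝ) * (x ^ 2) +
      ((a2 R * a1 (S ∪ R) : ℕ) : ℝ) * (x / √2) +
      ((a2 R * a2 (S ∪ R) : ℕ) : ℝ) := by
    intro R
    simp only [wt]; push_cast; ring
  simp only [e, Finset.sum_add_distrib, ← Finset.sum_mul, ← Nat.cast_sum]
  rw [h00, h01, h02, h10, h11, h12, h20, h21, h22]
  have h2 : (√2 : ℝ) ^ 2 = 2 := by norm_num
  have h3 : y / √2 * (x / √2) = y * x / 2 := by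
    rw [div_mul_div_comm, ← sq, h2]
  rw [h3]
  simp only [wt]
  push_cast
  field_simp
  ring

section
variable {V : Type*} [Fintype V] [DecidableEq V]

/-- Matchings of `G`, as involutions moving each vertex to itself or a neighbour. -/
def IsInv {V : Type*} (G : SimpleGraph V) (f : V → V) : Prop :=
  (∀ v, f (f v) = v) ∧ ∀ v, f v = v ∨ G.Adj v (f v)

open Classical in
/-- The finset of matchings. -/
noncomputable def mats (G : SimpleGraph V) : Finset (V → V) :=
  Finset.univ.filter (IsInv G)

theorem mem_mats (G : SimpleGraph V) (f : V → V) : f ∈ mats G ↔ IsInv G f := by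
  simp [mats]

/-- Levels used at `v`. -/
def used (σ : Fin 4 → V → V) (v : V) : Finset (Fin 4) :=
  Finset.univ.filter (fun i => σ i v ≠ v)

/-- Partition function. -/
noncomputable def ZZ (G : SimpleGraph V) (x : V → ℝ) : ℝ :=
  ∑ σ ∈ Fintype.piFinset (fun _ : Fin 4 => mats G), ∏ v, wt (x v) (used σ v)

/-- Glue the edge `l p` on the levels in `R`. -/
def glue (l p : V) (σ : Fin 4 → V → V) (R : Finset (Fin 4)) : Fin 4 → V → V :=
  fun i u => if i ∈ R then (if u = l then p else if u = p then l else σ i u) else σ i u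

/-- Remove the edge `l p` everywhere. -/
def unglue (l p : V) (σ : Fin 4 → V → V) : Fin 4 → V → V :=
  fun i u => if σ i l = p then (if u = l then l else if u = p then p else σ i u) else σ i u

theorem prod_two (l p : V) (hlp : l ≠ p) (f : V → ℝ) :
    ∏ v, f v = f l * f p * ∏ v ∈ (Finset.univ.erase l).erase p, f v := by
  rw [mul_assoc, Finset.mul_prod_erase _ _ (by simp [hlp.symm]),
    Finset.mul_prod_erase _ _ (by simp)]

theorem ZZ_step (G : SimpleGraph V) (x : V → ℝ) (hx : ∀ v, 0 < x v) (l p : V)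
    (hadj : G.Adj l p) (hleaf : ∀ w, G.Adj l w → w = p) :
    ZZ G x = ZZ (G.deleteEdges {s(l, p)}) (Function.update x p (x p + 1 / x l)) := by
  have hlp : l ≠ p := hadj.ne
  have hG' : ∀ a b, (G.deleteEdges {s(l, p)}).Adj a b ↔
      G.Adj a b ∧ ¬ (a = l ∧ b = p) ∧ ¬ (a = p ∧ b = l) := by
    intro a b
    simp only [SimpleGraph.deleteEdges_adj, Set.mem_singleton_iff, Sym2.eq_iff]
    tauto
  have hl' : ∀ b, ¬ (G.deleteEdges {s(l, p)}).Adj l b := by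
    intro b hb
    rw [hG'] at hb
    exact hb.2.1 ⟨rfl, hleaf b hb.1⟩
  have hfix : ∀ f, IsInv (G.deleteEdges {s(l, p)}) f → f l = l := by
    intro f hf
    exact (hf.2 l).resolve_right (hl' _)
  have key : ∀ σ ∈ Fintype.piFinset (fun _ : Fin 4 => mats (G.deleteEdges {s(l, p)})),
      ∏ v, wt (Function.update x p (x p + 1 / x l) v) (used σ v) =
      ∑ R ∈ (used σ p)ᶜ.powerset, ∏ v, wt (x v) (used (glue l p σ R) v) := by
    intro σ hσ
    simp only [Fintype.mem_piFinset, mem_mats] at hσ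
    have hσl : ∀ i, σ i l = l := fun i => hfix _ (hσ i)
    have hul : used σ l = ∅ := by simp [used, hσl]
    rw [prod_two l p hlp, hul]
    simp only [Function.update_self, Function.update_of_ne hlp, wt_empty]
    rw [← wt_step _ _ (hx l), Finset.sum_mul]
    refine Finset.sum_congr rfl fun R hR => ?_
    rw [Finset.mem_powerset] at hR
    rw [prod_two l p hlp (fun v => wt (x v) (used (glue l p σ R) v))]
    have e1 : used (glue l p σ R) l = R := by
      ext i
      simp only [used, glue, Finset.mem_filter, Finset.mem_univ, true_and, if_true, hσl]
      by_cases h : i ∈ R <;> simp [h, hlp.symm]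
    have e2 : used (glue l p σ R) p = used σ p ∪ R := by
      ext i
      simp only [used, glue, Finset.mem_filter, Finset.mem_univ, true_and, if_true,
        Finset.mem_union, if_neg hlp.symm]
      by_cases h : i ∈ R <;> simp [h, hlp]
    rw [e1, e2]
    congr 1
    refine Finset.prod_congr rfl fun v hv => ?_
    simp only [Finset.mem_erase, Finset.mem_univ, and_true] at hv
    rw [Function.update_of_ne hv.1]
    congr 1
    ext i
    simp [used, glue, hv.1, hv.2]
  unfold ZZ
  rw [Finset.sum_congr rfl key, Finset.sum_sigma']
  symm
  refine Finset.sum_bij' (fun a _ => glue l p a.1 a.2)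
    (fun σ _ => ⟨unglue l p σ, Finset.univ.filter (fun i => σ i l = p)⟩) ?_ ?_ ?_ ?_ ?_
  · rintro ⟨σ, R⟩ h
    simp only [Finset.mem_sigma, Fintype.mem_piFinset, mem_mats, Finset.mem_powerset] at h ⊢
    intro i
    have hi := h.1 i
    have hil := hfix _ hi
    by_cases hR : i ∈ R
    · have hp : σ i p = p := by
        have := h.2 hR
        simpa [used] using this
      refine ⟨fun v => ?_, fun v => ?_⟩
      · have h1 := hi.1 v
        simp only [glue, hR, if_true]
        grind
      · have h1 := hi.2 v
        rw [hG'] at h1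
        have := hadj.symm
        simp only [glue, hR, if_true]
        grind
    · refine ⟨fun v => ?_, fun v => ?_⟩
      · simpa [glue, hR] using hi.1 v
      · have h1 := hi.2 v
        rw [hG'] at h1
        simp only [glue, hR, if_false]
        tauto
  · intro σ h
    simp only [Finset.mem_sigma, Fintype.mem_piFinset, mem_mats, Finset.mem_powerset] at h ⊢
    refine ⟨fun i => ?_, ?_⟩
    · have hi := h i
      have hil := hi.1 l
      have hip := hi.1 p
      have hl2 := hi.2 l
      have hl3 := hleaf (σ i l)
      refine ⟨fun v => ?_, fun v => ?_⟩
      · have h1 := hi.1 v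
        simp only [unglue]
        grind
      · have h1 := hi.1 v
        have h2 := hi.2 v
        rw [hG']
        simp only [unglue]
        grind
    · intro i hi
      have hi : σ i l = p := by simpa using hi
      simp [used, unglue, hi, hlp.symm]
  · rintro ⟨σ, R⟩ h
    simp only [Finset.mem_sigma, Fintype.mem_piFinset, mem_mats, Finset.mem_powerset] at h
    have hl : ∀ i, σ i l = l := fun i => hfix _ (h.1 i)
    have hp : ∀ i ∈ R, σ i p = p := by
      intro i hi
      have := h.2 hi
      simpa [used] using this
    have e1 : unglue l p (glue l p σ R) = σ := by
      funext i u
      have := hl i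
      have := hp i
      simp only [unglue, glue]
      grind
    have e2 : Finset.univ.filter (fun i => glue l p σ R i l = p) = R := by
      ext i
      have := hl i
      simp only [glue, Finset.mem_filter, Finset.mem_univ, true_and]
      grind
    simp only [e1, e2]
  · intro σ h
    simp only [Fintype.mem_piFinset, mem_mats] at h
    funext i u
    have h1 := (h i).1 l
    simp only [glue, unglue, Finset.mem_filter, Finset.mem_univ, true_and]
    grind
  · intro a _
    rfl

open Classical in
/-- The matrix `diag x + s A`. -/
noncomputable def mat (G : SimpleGraph V) (x : V → ℝ) (s : ℂ) : Matrix V V ℂ :=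
  Matrix.of fun u v => (if u = v then (x u : ℂ) else 0) + s * (if G.Adj u v then 1 else 0)

theorem det_step (G : SimpleGraph V) (x : V → ℝ) (hx : ∀ v, 0 < x v) (s : ℂ) (hs : s * s = -1)
    (l p : V) (hadj : G.Adj l p) (hleaf : ∀ w, G.Adj l w → w = p) :
    (mat G x s).det =
      (mat (G.deleteEdges {s(l, p)}) (Function.update x p (x p + 1 / x l)) s).det := by
  have hlp : l ≠ p := hadj.ne
  have hx0 : (x l : ℂ) ≠ 0 := by exact_mod_cast (hx l).ne'
  have hleaf' : ∀ w, G.Adj w l → w = p := fun w h => hleaf w h.symm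
  rw [← Matrix.det_updateRow_add_smul_self (mat G x s) hlp.symm (-s / x l),
    ← Matrix.det_updateCol_add_smul_self _ hlp.symm (-s / x l)]
  congr 1
  have hG' : ∀ a b, (G.deleteEdges {s(l, p)}).Adj a b ↔
      G.Adj a b ∧ ¬ (a = l ∧ b = p) ∧ ¬ (a = p ∧ b = l) := by
    intro a b
    simp only [SimpleGraph.deleteEdges_adj, Set.mem_singleton_iff, Sym2.eq_iff]
    tauto
  have hG2 : ∀ a b c d, G.Adj c d → ¬ (a = c ∧ b = d) → ¬ (a = d ∧ b = c) →
      ((G.deleteEdges {s(c, d)}).Adj a b ↔ G.Adj a b) := by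
    intro a b c d _ h1 h2
    simp only [SimpleGraph.deleteEdges_adj, Set.mem_singleton_iff, Sym2.eq_iff]
    tauto
  have hll : ∀ b, G.Adj l b ↔ b = p := fun b => ⟨hleaf b, fun h => h ▸ hadj⟩
  have hll' : ∀ b, G.Adj b l ↔ b = p := fun b => ⟨hleaf' b, fun h => h ▸ hadj.symm⟩
  ext a b
  by_cases ha : a = p
  · subst ha
    by_cases hb : b = a
    · subst hb
      simp [mat, Matrix.updateRow_apply, Matrix.updateCol_apply, hG', hll, hll', hlp, hlp.symm]
      field_simp
      linear_combination -hs
    · by_cases hbl : b = l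
      · subst hbl
        simp [mat, Matrix.updateRow_apply, Matrix.updateCol_apply, hG', hll, hll', hlp, hlp.symm]
        field_simp
        ring
      · simp [mat, Matrix.updateRow_apply, Matrix.updateCol_apply, hG', hll, hll', hb, hbl,
          Ne.symm hb, Ne.symm hbl]
        have hiff := hG2 a b l a hadj (by tauto) (by tauto); split_ifs <;> tauto
  · by_cases hal : a = l
    · subst hal
      by_cases hb : b = p
      · subst hb
        simp [mat, Matrix.updateRow_apply, Matrix.updateCol_apply, hG', hll, hll', hlp, hlp.symm]
        field_simp
        ring
      · simp [mat, Matrix.updateRow_apply, Matrix.updateCol_apply, hG', hll, hll', hb, ha]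
    · by_cases hb : b = p
      · subst hb
        simp [mat, Matrix.updateRow_apply, Matrix.updateCol_apply, hG', hll, hll', ha, hal]
        have hiff := hG2 a b l b hadj (by tauto) (by tauto); split_ifs <;> tauto
      · simp [mat, Matrix.updateRow_apply, Matrix.updateCol_apply, hG', hll, hll', ha, hal, hb,
          Function.update_of_ne]
        have hiff := hG2 a b l p hadj (by tauto) (by tauto); split_ifs <;> tauto

theorem exists_leaf (G : SimpleGraph V) (h : G.IsAcyclic) (hne : G ≠ ⊥) :
    ∃ l p, G.Adj l p ∧ ∀ w, G.Adj l w → w = p := by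
  obtain ⟨a, b, hab⟩ := SimpleGraph.ne_bot_iff_exists_adj.mp hne
  haveI : Nonempty V := ⟨a⟩
  have ⟨u, v, p, hp, hmax⟩ := SimpleGraph.Walk.exists_isPath_forall_isPath_length_le_length G
  have hnil : ¬p.Nil := by
    intro hn
    have h1 := hmax _ _ _ (SimpleGraph.Path.singleton hab).2
    have h2 := SimpleGraph.Walk.nil_iff_length_eq.mp hn
    simp [SimpleGraph.Path.singleton] at h1
    omega
  refine ⟨u, p.snd, p.adj_snd hnil, fun w hadj ↦ ?_⟩
  apply h.eq_snd_of_adj_start hp hadj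
  have : ¬(p.cons hadj.symm).IsPath := by grind [SimpleGraph.Walk.length_cons]
  grind [hp.cons]

theorem ZZ_eq (G : SimpleGraph V) (hG : G.IsAcyclic) : ∀ (x : V → ℝ), (∀ v, 0 < x v) →
    ((ZZ G x : ℝ) : ℂ) = (mat G x Complex.I).det * (mat G x (-Complex.I)).det := by
  induction G using WellFoundedLT.induction with
  | ind G ih =>
  intro x hx
  by_cases hne : G = ⊥
  · subst hne
    have hm : mats (⊥ : SimpleGraph V) = {id} := by
      ext f
      simp only [mem_mats, Finset.mem_singleton, IsInv, SimpleGraph.bot_adj, or_false]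
      constructor
      · intro h; funext v; exact h.2 v
      · rintro rfl; simp
    have hd : ∀ s, mat (⊥ : SimpleGraph V) x s = Matrix.diagonal (fun v => (x v : ℂ)) := by
      intro s; ext a b
      simp [mat, Matrix.diagonal_apply]
    rw [hd, hd, Matrix.det_diagonal, ZZ, hm, Fintype.piFinset_singleton, Finset.sum_singleton]
    have hu : ∀ v : V, used (fun _ : Fin 4 => (id : V → V)) v = ∅ := by
      intro v; simp [used]
    simp only [hu, wt_empty]
    push_cast
    rw [← Finset.prod_mul_distrib]
    simp only [sq]
  · obtain ⟨l, p, hadj, hleaf⟩ := exists_leaf G hG hne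
    rw [ZZ_step G x hx l p hadj hleaf,
      det_step G x hx _ (by simp) l p hadj hleaf,
      det_step G x hx (-Complex.I) (by simp) l p hadj hleaf]
    have hle := G.deleteEdges_le {s(l, p)}
    refine ih _ (lt_of_le_of_ne hle ?_) (hG.anti hle) _ ?_
    · intro he
      have : (G.deleteEdges {s(l, p)}).Adj l p := by rw [he]; exact hadj
      simp at this
    · intro v
      have := hx l
      have := hx p
      by_cases hv : v = p
      · subst hv; simp; positivity
      · simp [hv, hx]

theorem det_eq (T : SimpleGraph V) [DecidableRel T.Adj] :
    (mat T (fun _ => √2) Complex.I).det * (mat T (fun _ => √2) (-Complex.I)).det =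
      (((((T.adjMatrix ℝ).charpoly.roots).map (fun θ => 2 + θ ^ 2)).prod : ℝ) : ℂ) := by
  have hA : (T.adjMatrix ℝ).IsHermitian := by
    rw [Matrix.IsHermitian, Matrix.conjTranspose_eq_transpose_of_trivial]
    simp
  set B : Matrix V V ℂ := (T.adjMatrix ℝ).map (algebraMap ℝ ℂ) with hB
  have hs2 : ((√2 : ℝ) : ℂ) * ((√2 : ℝ) : ℂ) = 2 := by
    rw [← Complex.ofReal_mul]; norm_num
  have hev : ∀ z : ℂ, (Matrix.scalar V z - B).det = ∏ i, (z - (hA.eigenvalues i : ℂ)) := by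
    intro z
    rw [← Matrix.eval_charpoly, hB, Matrix.charpoly_map, hA.charpoly_eq, Polynomial.map_prod,
      Polynomial.eval_prod]
    simp
  have h1 : mat T (fun _ => √2) Complex.I =
      (-Complex.I) • (Matrix.scalar V (Complex.I * √2) - B) := by
    ext a b
    by_cases hab : a = b
    · subst hab
      simp [mat, hB, ← mul_assoc]
    · by_cases hadj : T.Adj a b <;> simp [mat, hB, hab, SimpleGraph.adjMatrix_apply, hadj]
  have h2 : mat T (fun _ => √2) (-Complex.I) =
      Complex.I • (Matrix.scalar V (-Complex.I * √2) - B) := by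
    ext a b
    by_cases hab : a = b
    · subst hab
      simp [mat, hB, ← mul_assoc]
    · by_cases hadj : T.Adj a b <;> simp [mat, hB, hab, SimpleGraph.adjMatrix_apply, hadj]
  rw [h1, h2, Matrix.det_smul, Matrix.det_smul, hev, hev, hA.roots_charpoly_eq_eigenvalues,
    Multiset.map_map]
  change _ = ((∏ i, (2 + (hA.eigenvalues i) ^ 2) : ℝ) : ℂ)
  push_cast
  rw [mul_mul_mul_comm, ← mul_pow, ← Finset.prod_mul_distrib]
  simp only [neg_mul, Complex.I_mul_I, neg_neg, one_pow, one_mul]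
  refine Finset.prod_congr rfl fun i _ => ?_
  linear_combination (-Complex.I * Complex.I) * hs2 - 2 * Complex.I_mul_I

/-- Local count: matchings of the 4-cycle with prescribed set of unmatched vertices. -/
def loc (S : Finset (Fin 4)) : Finset (Fin 4 → Fin 4) :=
  Finset.univ.filter (fun f => (∀ i, f (f i) = i) ∧
    (∀ i, f i = i ∨ (cycleGraph 4).Adj i (f i)) ∧ ∀ i, f i = i ↔ i ∈ S)

theorem card_loc : ∀ S, (loc S).card = 2 * a0 S + a1 S + a2 S := by
  decide +kernel

theorem wt_sqrt (S : Finset (Fin 4)) : wt (√2) S = ((loc S).card : ℝ) := by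
  rw [card_loc, wt]
  have : √2 / √2 = (1 : ℝ) := div_self (by positivity)
  rw [this]
  push_cast
  norm_num
  ring

/-- Configurations. -/
noncomputable def confs (T : SimpleGraph V) :
    Finset (Σ _ : Fin 4 → V → V, V → Fin 4 → Fin 4) :=
  (Fintype.piFinset (fun _ : Fin 4 => mats T)).sigma
    (fun σ => Fintype.piFinset (fun v => loc (used σ v)))

theorem card_confs (T : SimpleGraph V) : ((confs T).card : ℝ) = ZZ T (fun _ => √2) := by
  simp [confs, ZZ, wt_sqrt, Finset.card_sigma, Fintype.card_piFinset]

theorem mem_confs (T : SimpleGraph V) (c : Σ _ : Fin 4 → V → V, V → Fin 4 → Fin 4) :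
    c ∈ confs T ↔ (∀ i, IsInv T (c.1 i)) ∧ (∀ v, IsInv (cycleGraph 4) (c.2 v)) ∧
      ∀ v i, c.2 v i = i ↔ c.1 i v ≠ v := by
  simp only [confs, Finset.mem_sigma, Fintype.mem_piFinset, mem_mats, loc, used,
    Finset.mem_filter, Finset.mem_univ, true_and, IsInv]
  constructor
  · rintro ⟨h1, h2⟩
    exact ⟨h1, fun v => ⟨(h2 v).1, (h2 v).2.1⟩, fun v => (h2 v).2.2⟩
  · rintro ⟨h1, h2, h3⟩
    exact ⟨h1, fun v => ⟨(h2 v).1, (h2 v).2, h3 v⟩⟩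

/-- The partner function of a configuration. -/
def partner (c : Σ _ : Fin 4 → V → V, V → Fin 4 → Fin 4) (a : Fin 4 × V) : Fin 4 × V :=
  (c.2 a.2 a.1, c.1 a.1 a.2)

theorem ncard_eq (T : SimpleGraph V) :
    Pm (cycleGraph 4 □ T) = (confs T).card := by
  rw [Pm, ← Set.ncard_coe_finset]
  symm
  have hadj : ∀ c ∈ confs T, ∀ a, (cycleGraph 4 □ T).Adj a (partner c a) := by
    intro c hc a
    rw [mem_confs] at hc
    obtain ⟨h1, h2, h3⟩ := hc
    rw [boxProd_adj]
    have e1 := (h1 a.1).2 a.2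
    have e2 := (h2 a.2).2 a.1
    have e3 := h3 a.2 a.1
    simp only [partner]
    grind
  have hinv : ∀ c ∈ confs T, ∀ a, partner c (partner c a) = a := by
    rintro c hc ⟨i, v⟩
    rw [mem_confs] at hc
    obtain ⟨h1, h2, h3⟩ := hc
    have e1 := (h1 i).1 v
    have e2 := (h2 v).1 i
    have e3 := h3 v i
    have e4 := h3 (c.1 i v) i
    have e5 := h3 v (c.2 v i)
    simp only [partner, Prod.mk.injEq]
    grind
  refine Set.ncard_congr (fun c hc =>
    { verts := Set.univ
      Adj := fun a b => partner c a = b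
      adj_sub := ?_
      edge_vert := fun _ => Set.mem_univ _
      symm := ?_ }) ?_ ?_ ?_
  · rintro a b rfl
    exact hadj c hc a
  · constructor
    rintro a b rfl
    exact hinv c hc a
  · intro c hc
    rw [Set.mem_ofPred_eq, Subgraph.isPerfectMatching_iff]
    intro a
    exact ⟨partner c a, rfl, fun b hb => Eq.symm hb⟩
  · intro c d hc hd h
    have h' := congrArg Subgraph.Adj h
    have hp : ∀ a, partner d a = partner c a := by
      intro a
      have := congrFun (congrFun h' a) (partner c a)
      simpa using this
    obtain ⟨c1, c2⟩ := c
    obtain ⟨d1, d2⟩ := d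
    simp only [partner, Prod.mk.injEq, Prod.forall] at hp
    have e1 : c1 = d1 := by
      funext i v; exact (hp i v).2.symm
    have e2 : c2 = d2 := by
      funext v i; exact (hp i v).1.symm
    rw [e1, e2]
  · intro M hM
    rw [Set.mem_ofPred_eq, Subgraph.isPerfectMatching_iff] at hM
    choose g hg hg' using hM
    have hgg : ∀ a, g (g a) = a := fun a => ((hg' (g a)) a (hg a).symm).symm
    have hga : ∀ a, (cycleGraph 4).Adj a.1 (g a).1 ∧ a.2 = (g a).2 ∨
        T.Adj a.2 (g a).2 ∧ a.1 = (g a).1 := by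
      intro a
      exact boxProd_adj.mp (M.adj_sub (hg a))
    refine ⟨⟨fun i v => (g (i, v)).2, fun v i => (g (i, v)).1⟩, ?_, ?_⟩
    · rw [Finset.mem_coe, mem_confs]
      refine ⟨fun i => ⟨fun v => ?_, fun v => ?_⟩, fun v => ⟨fun i => ?_, fun i => ?_⟩,
        fun v i => ?_⟩
      · have h1 := hga (i, v)
        have h2 := hgg (i, v)
        rcases h1 with h1 | h1
        · have e : (g (i, v)).2 = v := h1.2.symm
          simp only [e]
        · have e : g (i, v) = (i, (g (i, v)).2) := Prod.ext h1.2.symm rfl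
          simp only
          rw [← e, h2]
      · have h1 := hga (i, v)
        simp only at h1 ⊢
        tauto
      · have h1 := hga (i, v)
        have h2 := hgg (i, v)
        rcases h1 with h1 | h1
        · have e : g (i, v) = ((g (i, v)).1, v) := Prod.ext rfl h1.2.symm
          simp only
          rw [← e, h2]
        · have e : (g (i, v)).1 = i := h1.2.symm
          simp only [e]
      · have h1 := hga (i, v)
        simp only at h1 ⊢
        tauto
      · have h1 := hga (i, v)
        simp only at h1 ⊢
        rcases h1 with h1 | h1
        · have := h1.1.ne
          grind
        · have := h1.1.ne
          grind
    · refine Subgraph.ext ?_ ?_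
      · ext a
        simp only [Set.mem_univ, true_iff]
        exact M.edge_vert (hg a)
      · funext a b
        simp only [partner, eq_iff_iff]
        constructor
        · rintro rfl
          exact hg a
        · intro h
          exact (hg' a b h).symm

end
end PmC4

/-- Let `T` be a tree on `n` vertices with eigenvalues (with multiplicity)
`θ_1, …, θ_n`.  Then `Pm(C_4 × T) = ∏_{j=1}^n (2 + θ_j^2)`. -/
theorem pm_c4_boxProd_tree {V : Type*} [Fintype V] [DecidableEq V]
    (T : SimpleGraph V) [DecidableRel T.Adj] (hT : T.IsTree) :
    (Pm (cycleGraph 4 □ T) : ℝ) =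
      (((T.adjMatrix ℝ).charpoly.roots).map (fun θ => 2 + θ ^ 2)).prod := by
  have h1 := PmC4.ZZ_eq T hT.isAcyclic (fun _ => √2) (fun _ => by positivity)
  rw [PmC4.det_eq] at h1
  have h2 := Complex.ofReal_injective h1
  rw [← h2, PmC4.ncard_eq, PmC4.card_confs]
end

section
/- For every positive integer n, the number of perfect matchings of the Cartesian product C_4 × P_n (the linear 2×2×n cubic lattice) equals ∏_{k=1}^{n} (2 + 4 cos²(kπ/(n+1))), where C_4 is the cycle on 4 vertices and P_n the path on n vertices. -/
open SimpleGraph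

namespace PmAux

/-- A set of vertices (or edges) of `C_4`. -/
abbrev St := Fin 4 → Bool

/-- Local exact-cover condition for one layer: `S` edges from below, `T` edges to above,
`H` horizontal edges. -/
def ok (S T H : St) : Prop :=
  ∀ v, (S v).toNat + (T v).toNat + (H v).toNat + (H (v - 1)).toNat = 1

instance (S T H : St) : Decidable (ok S T H) := by unfold ok; infer_instance

/-- Layered encodings of the matchings. -/
def Q (n : ℕ) (S : St) : Type :=
  {p : (Fin (n + 1) → St) × (Fin n → St) //
    p.1 0 = S ∧ p.1 (Fin.last n) = (fun _ => false) ∧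
      ∀ i : Fin n, ok (p.1 i.castSucc) (p.1 i.succ) (p.2 i)}

noncomputable instance (n : ℕ) (S : St) : Fintype (Q n S) := by
  classical
  unfold Q
  infer_instance

noncomputable def W (n : ℕ) (S : St) : ℕ := Fintype.card (Q n S)

def QEquiv (n : ℕ) (S : St) :
    Q (n + 1) S ≃ Σ T : St, {H : St // ok S T H} × Q n T where
  toFun p := ⟨p.1.1 1, ⟨p.1.2 0, by
      have := p.2.2.2 0
      rw [Fin.castSucc_zero, p.2.1] at this
      exact this⟩,
    ⟨(fun j => p.1.1 j.succ, fun i => p.1.2 i.succ), by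
      refine ⟨rfl, p.2.2.1, fun i => ?_⟩
      have := p.2.2.2 i.succ
      exact this⟩⟩
  invFun q := ⟨(Fin.cons S q.2.2.1.1, Fin.cons q.2.1.1 q.2.2.1.2), by
      refine ⟨rfl, ?_, ?_⟩
      · have := q.2.2.2.2.1
        rw [← Fin.succ_last]
        simpa using this
      · intro i
        refine Fin.cases ?_ (fun i => ?_) i
        · have := q.2.2.2.1
          have h2 := q.2.1.2
          simpa [this] using h2
        · have := q.2.2.2.2.2 i
          simpa [← Fin.succ_castSucc] using this⟩
  left_inv p := by
    apply Subtype.ext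
    refine Prod.ext ?_ ?_
    · funext j
      refine Fin.cases ?_ (fun i => ?_) j
      · exact p.2.1.symm
      · rfl
    · funext j
      refine Fin.cases ?_ (fun i => ?_) j
      · rfl
      · rfl
  right_inv q := by
    obtain ⟨T, ⟨H, hH⟩, ⟨⟨c, h⟩, h1, h2, h3⟩⟩ := q
    simp only at h1
    subst h1
    rfl

lemma W_succ (n : ℕ) (S : St) :
    W (n + 1) S = ∑ T : St, (Finset.univ.filter (fun H : St => ok S T H)).card * W n T := by
  unfold W
  rw [Fintype.card_congr (QEquiv n S), Fintype.card_sigma]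
  refine Finset.sum_congr rfl fun T _ => ?_
  rw [Fintype.card_prod, Fintype.card_subtype]

lemma W_zero (S : St) : W 0 S = if S = (fun _ => false) then 1 else 0 := by
  unfold W
  split_ifs with h
  · rw [Fintype.card_eq_one_iff]
    refine ⟨⟨(fun _ => S, Fin.elim0), rfl, h, fun i => i.elim0⟩, ?_⟩
    rintro ⟨⟨c, k⟩, h1, h2, h3⟩
    apply Subtype.ext
    refine Prod.ext ?_ ?_
    · funext j
      obtain rfl : j = 0 := Fin.ext (by have := j.2; simp)
      exact h1
    · funext j
      exact j.elim0
  · rw [Fintype.card_eq_zero_iff]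
    refine ⟨?_⟩
    rintro ⟨⟨c, k⟩, h1, h2, h3⟩
    exact h (h1.symm.trans h2)

abbrev E0 : St := fun _ => false
abbrev E4 : St := fun _ => true
abbrev pr (i : Fin 4) : St := fun v => decide (v = i ∨ v = i + 1)

set_option maxRecDepth 100000 in
lemma cnt0 : ∀ T : St, (Finset.univ.filter (fun H : St => ok E0 T H)).card =
    (if T = E0 then 2 else 0) + (if T = pr 0 then 1 else 0) + (if T = pr 1 then 1 else 0)
    + (if T = pr 2 then 1 else 0) + (if T = pr 3 then 1 else 0) + (if T = E4 then 1 else 0) := by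
  decide +kernel

lemma cnt4 : ∀ T : St, (Finset.univ.filter (fun H : St => ok E4 T H)).card =
    (if T = E0 then 1 else 0) := by
  decide +kernel

lemma cntp : ∀ i : Fin 4, ∀ T : St, (Finset.univ.filter (fun H : St => ok (pr i) T H)).card =
    (if T = E0 then 1 else 0) + (if T = pr (i + 2) then 1 else 0) := by
  decide +kernel

lemma W0_succ (n : ℕ) : W (n + 1) E0 =
    2 * W n E0 + W n (pr 0) + W n (pr 1) + W n (pr 2) + W n (pr 3) + W n E4 := by
  rw [W_succ]
  simp only [cnt0, add_mul, ite_mul, zero_mul, one_mul, Finset.sum_add_distrib,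
    Finset.sum_ite_eq', Finset.mem_univ, if_true]

lemma W4_succ (n : ℕ) : W (n + 1) E4 = W n E0 := by
  rw [W_succ]
  simp only [cnt4, ite_mul, zero_mul, one_mul, 
    Finset.sum_ite_eq', Finset.mem_univ, if_true]

lemma Wp_succ (n : ℕ) (i : Fin 4) : W (n + 1) (pr i) = W n E0 + W n (pr (i + 2)) := by
  rw [W_succ]
  simp only [cntp, add_mul, ite_mul, zero_mul, one_mul, Finset.sum_add_distrib,
    Finset.sum_ite_eq', Finset.mem_univ, if_true]

lemma Wp_eq (n : ℕ) : ∀ i, W n (pr i) = W n (pr 0) := by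
  induction n with
  | zero =>
    intro i
    have h : ∀ i, pr i ≠ (fun _ => false) := by decide
    rw [W_zero, W_zero, if_neg (h i), if_neg (h 0)]
  | succ n ih =>
    intro i
    rw [Wp_succ, Wp_succ, ih (i + 2), ih (0 + 2)]

open Polynomial Polynomial.Chebyshev in
lemma W_eq (z : ℂ) (hz : z ^ 2 = -1 / 2) (n : ℕ) :
    (W n E0 : ℂ) = (U ℂ n).eval z * (U ℂ n).eval (-z) ∧
    (W n E4 : ℂ) = (U ℂ (n - 1)).eval z * (U ℂ (n - 1)).eval (-z) ∧
    (4 * W n (pr 0) : ℂ) = -2 * z * ((U ℂ n).eval z * (U ℂ (n - 1)).eval (-z)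
      - (U ℂ (n - 1)).eval z * (U ℂ n).eval (-z)) := by
  induction n with
  | zero =>
    have h : pr 0 ≠ (fun _ => false) := by decide
    have h' : E4 ≠ (fun _ => false) := by decide
    rw [W_zero, W_zero, W_zero, if_neg h, if_neg h', if_pos rfl]
    simp
  | succ n ih =>
    obtain ⟨h1, h2, h3⟩ := ih
    rw [W0_succ, W4_succ, Wp_succ, Wp_eq n (0 + 2), Wp_eq n 1, Wp_eq n 2, Wp_eq n 3]
    push_cast
    rw [add_sub_cancel_right, U_add_one]
    simp only [eval_sub, eval_mul, eval_X, eval_ofNat]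
    refine ⟨?_, h1, ?_⟩
    · linear_combination 2 * h1 + h2 + h3 + 4 * (U ℂ n).eval z * (U ℂ n).eval (-z) * hz
    · linear_combination 4 * h1 + h3 + 8 * (U ℂ n).eval z * (U ℂ n).eval (-z) * hz

open Polynomial Polynomial.Chebyshev in
lemma U_prod (n : ℕ) (z : ℂ) : (U ℂ n).eval z =
    ∏ k ∈ Finset.range n, (2 * z - 2 * ((Real.cos ((k + 1) * Real.pi / (n + 1)) : ℝ) : ℂ)) := by
  have hinj : Set.InjOn (fun (k : ℕ) => Real.cos ((k + 1) * Real.pi / (n + 1)))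
      (Finset.range n) := (Finset.range n).nodup_map_iff_injOn.mp (roots_U_real_nodup n)
  have hcard : (U ℝ n).roots.card = (U ℝ n).natDegree := by
    rw [roots_U_real, natDegree_U_natCast, Finset.card_val, Finset.card_image_of_injOn hinj,
      Finset.card_range]
  have h := C_leadingCoeff_mul_prod_multiset_X_sub_C hcard
  rw [roots_U_real, leadingCoeff_U_natCast] at h
  change Polynomial.C _ * (∏ a ∈ Finset.image _ _, (X - Polynomial.C a)) = _ at h
  rw [Finset.prod_image hinj] at h
  rw [← aeval_U (R := ℝ) z, ← h, map_mul, map_prod]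
  simp only [map_sub, aeval_X, Polynomial.aeval_C, map_pow, map_ofNat]
  simp only [← mul_sub, Finset.prod_mul_distrib, Finset.prod_const, Finset.card_range]
  rfl

lemma W_real (n : ℕ) : (W n E0 : ℝ) =
    ∏ k ∈ Finset.Icc 1 n, (2 + 4 * Real.cos (k * Real.pi / (n + 1)) ^ 2) := by
  obtain ⟨z, hz⟩ := IsAlgClosed.exists_pow_nat_eq (-1 / 2 : ℂ) (n := 2) (by norm_num)
  have h := (W_eq z hz n).1
  rw [U_prod, U_prod, ← Finset.prod_mul_distrib] at h
  rw [← Finset.Ico_add_one_right_eq_Icc, Finset.prod_Ico_eq_prod_range]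
  have : ((W n E0 : ℝ) : ℂ) = ((∏ k ∈ Finset.range (n + 1 - 1),
      (2 + 4 * Real.cos (((1 + k : ℕ) : ℝ) * Real.pi / (n + 1)) ^ 2) : ℝ) : ℂ) := by
    rw [Complex.ofReal_natCast, h, Complex.ofReal_prod]
    refine Finset.prod_congr rfl fun k _ => ?_
    rw [show ((1 + k : ℕ) : ℝ) = (k : ℝ) + 1 by push_cast; ring]
    generalize Real.cos _ = x
    push_cast
    linear_combination -4 * hz
  exact_mod_cast this

/-- Adjacency from an encoding. -/
def R {n : ℕ} (c : Fin (n + 1) → St) (h : Fin n → St) (a b : Fin 4 × Fin n) : Prop :=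
  (a.2 = b.2 ∧ ((b.1 = a.1 + 1 ∧ h a.2 a.1 = true) ∨ (a.1 = b.1 + 1 ∧ h a.2 b.1 = true))) ∨
  (a.1 = b.1 ∧ ((a.2.val + 1 = b.2.val ∧ c b.2.castSucc a.1 = true) ∨
    (b.2.val + 1 = a.2.val ∧ c a.2.castSucc a.1 = true)))

lemma adj_iff {n : ℕ} (a b : Fin 4 × Fin n) : (cycleGraph 4 □ pathGraph n).Adj a b ↔
    (a.2 = b.2 ∧ (b.1 = a.1 + 1 ∨ a.1 = b.1 + 1)) ∨
    (a.1 = b.1 ∧ (a.2.val + 1 = b.2.val ∨ b.2.val + 1 = a.2.val)) := by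
  have : ∀ v w : Fin 4, (cycleGraph 4).Adj v w ↔ (w = v + 1 ∨ v = w + 1) := by
    intro v w
    rw [cycleGraph_adj]
    revert v w
    decide
  rw [boxProd_adj, this, pathGraph_adj]
  tauto

lemma one_iff (a b c d : Bool) : a.toNat + b.toNat + c.toNat + d.toNat = 1 ↔
    (a = true ∧ b = false ∧ c = false ∧ d = false) ∨ (a = false ∧ b = true ∧ c = false ∧ d = false)
    ∨ (a = false ∧ b = false ∧ c = true ∧ d = false)
    ∨ (a = false ∧ b = false ∧ c = false ∧ d = true) := by
  revert a b c d; decide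

lemma R_cases {n : ℕ} (c : Fin (n + 1) → St) (h : Fin n → St)
    (v : Fin 4) (i : Fin n) (b : Fin 4 × Fin n) : R c h (v, i) b ↔
      (b = (v + 1, i) ∧ h i v = true) ∨ (b = (v - 1, i) ∧ h i (v - 1) = true) ∨
      (b.1 = v ∧ i.val + 1 = b.2.val ∧ c i.succ v = true) ∨
      (b.1 = v ∧ b.2.val + 1 = i.val ∧ c i.castSucc v = true) := by
  obtain ⟨w, j⟩ := b
  have h1 : v = w + 1 ↔ w = v - 1 := by revert v w; decide
  have h2 : i.val + 1 = j.val → j.castSucc = i.succ := fun h => by ext; simp [h]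
  simp only [R, Prod.mk.injEq, h1]
  constructor
  · rintro (⟨rfl, ⟨rfl, h⟩ | ⟨rfl, h⟩⟩ | ⟨rfl, ⟨h3, h⟩ | ⟨h3, h⟩⟩)
    · simp [h]
    · simp [h]
    · rw [h2 h3] at h
      simp [h, h3]
    · simp [h, h3]
  · rintro (⟨⟨rfl, rfl⟩, h⟩ | ⟨⟨rfl, rfl⟩, h⟩ | ⟨rfl, h3, h⟩ | ⟨rfl, h3, h⟩)
    · simp [h]
    · simp [h]
    · rw [← h2 h3] at h
      simp [h, h3]
    · simp [h, h3]

lemma key {n : ℕ} (c : Fin (n + 1) → St) (h : Fin n → St)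
    (h0 : c 0 = fun _ => false) (hl : c (Fin.last n) = fun _ => false)
    (v : Fin 4) (i : Fin n) : (∃! b, R c h (v, i) b) ↔
      (c i.castSucc v).toNat + (c i.succ v).toNat + (h i v).toNat + (h i (v - 1)).toNat = 1 := by
  have hv1 : v + 1 ≠ v - 1 := by revert v; decide
  have hv2 : v + 1 ≠ v := by revert v; decide
  have hv3 : v - 1 ≠ v := by revert v; decide
  have hup : c i.succ v = true → ∃ j : Fin n, i.val + 1 = j.val := by
    intro hc
    by_contra hno
    have : i.succ = Fin.last n := by
      ext
      by_contra hne
      apply hno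
      have := i.2
      simp at hne
      exact ⟨⟨i.val + 1, by omega⟩, rfl⟩
    rw [this, hl] at hc
    simp at hc
  have hdn : c i.castSucc v = true → ∃ j : Fin n, j.val + 1 = i.val := by
    intro hc
    by_contra hno
    have : i.castSucc = 0 := by
      ext
      by_contra hne
      apply hno
      have := i.2
      simp at hne
      exact ⟨⟨i.val - 1, by omega⟩, by simp; omega⟩
    rw [this, h0] at hc
    simp at hc
  rw [one_iff]
  -- the four candidate neighbours
  have r1 : h i v = true → R c h (v, i) (v + 1, i) := fun hh => by
    rw [R_cases]; exact Or.inl ⟨rfl, hh⟩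
  have r2 : h i (v - 1) = true → R c h (v, i) (v - 1, i) := fun hh => by
    rw [R_cases]; exact Or.inr (Or.inl ⟨rfl, hh⟩)
  have r3 : c i.succ v = true → ∃ j : Fin n, i.val + 1 = j.val ∧ R c h (v, i) (v, j) := fun hh => by
    obtain ⟨j, hj⟩ := hup hh
    refine ⟨j, hj, ?_⟩
    rw [R_cases]; exact Or.inr (Or.inr (Or.inl ⟨rfl, hj, hh⟩))
  have r4 : c i.castSucc v = true → ∃ j : Fin n, j.val + 1 = i.val ∧ R c h (v, i) (v, j) :=
    fun hh => by
    obtain ⟨j, hj⟩ := hdn hh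
    refine ⟨j, hj, ?_⟩
    rw [R_cases]; exact Or.inr (Or.inr (Or.inr ⟨rfl, hj, hh⟩))
  constructor
  · rintro ⟨b, hb, hu⟩
    have n12 : ¬ (h i v = true ∧ h i (v - 1) = true) := fun ⟨x, y⟩ => by
      have := (hu _ (r1 x)).trans (hu _ (r2 y)).symm
      simp only [Prod.mk.injEq] at this
      exact hv1 this.1
    have n13 : ¬ (h i v = true ∧ c i.succ v = true) := fun ⟨x, y⟩ => by
      obtain ⟨j, hj, hr⟩ := r3 y
      have := (hu _ (r1 x)).trans (hu _ hr).symm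
      simp only [Prod.mk.injEq] at this
      exact hv2 this.1
    have n14 : ¬ (h i v = true ∧ c i.castSucc v = true) := fun ⟨x, y⟩ => by
      obtain ⟨j, hj, hr⟩ := r4 y
      have := (hu _ (r1 x)).trans (hu _ hr).symm
      simp only [Prod.mk.injEq] at this
      exact hv2 this.1
    have n23 : ¬ (h i (v - 1) = true ∧ c i.succ v = true) := fun ⟨x, y⟩ => by
      obtain ⟨j, hj, hr⟩ := r3 y
      have := (hu _ (r2 x)).trans (hu _ hr).symm
      simp only [Prod.mk.injEq] at this
      exact hv3 this.1
    have n24 : ¬ (h i (v - 1) = true ∧ c i.castSucc v = true) := fun ⟨x, y⟩ => by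
      obtain ⟨j, hj, hr⟩ := r4 y
      have := (hu _ (r2 x)).trans (hu _ hr).symm
      simp only [Prod.mk.injEq] at this
      exact hv3 this.1
    have n34 : ¬ (c i.succ v = true ∧ c i.castSucc v = true) := fun ⟨x, y⟩ => by
      obtain ⟨j, hj, hr⟩ := r3 x
      obtain ⟨j', hj', hr'⟩ := r4 y
      have := (hu _ hr).trans (hu _ hr').symm
      simp only [Prod.mk.injEq] at this
      have := congrArg Fin.val this.2
      omega
    have hor : h i v = true ∨ h i (v - 1) = true ∨ c i.succ v = true ∨ c i.castSucc v = true := by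
      rw [R_cases] at hb
      rcases hb with hb | hb | hb | hb
      · exact Or.inl hb.2
      · exact Or.inr (Or.inl hb.2)
      · exact Or.inr (Or.inr (Or.inl hb.2.2))
      · exact Or.inr (Or.inr (Or.inr hb.2.2))
    clear r1 r2 r3 r4 hup hdn hb hu
    generalize h i v = x1 at *
    generalize h i (v - 1) = x2 at *
    generalize c i.succ v = x3 at *
    generalize c i.castSucc v = x4 at *
    clear hv1 hv2 hv3 b h0 hl
    cases x1 <;> cases x2 <;> cases x3 <;> cases x4 <;> simp_all
  · rintro (⟨x1, x2, x3, x4⟩ | ⟨x1, x2, x3, x4⟩ | ⟨x1, x2, x3, x4⟩ | ⟨x1, x2, x3, x4⟩)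
    · obtain ⟨j, hj, hr⟩ := r4 x1
      refine ⟨_, hr, fun b hb => ?_⟩
      simp only [R_cases, x1, x2, x3, x4] at hb
      simp at hb
      exact Prod.ext hb.1 (Fin.ext (by simp only; omega))
    · obtain ⟨j, hj, hr⟩ := r3 x2
      refine ⟨_, hr, fun b hb => ?_⟩
      simp only [R_cases, x1, x2, x3, x4] at hb
      simp at hb
      exact Prod.ext hb.1 (Fin.ext (by simp only; omega))
    · refine ⟨_, r1 x3, fun b hb => ?_⟩
      simp only [R_cases, x1, x2, x3, x4] at hb
      simpa using hb
    · refine ⟨_, r2 x4, fun b hb => ?_⟩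
      simp only [R_cases, x1, x2, x3, x4] at hb
      simpa using hb

abbrev G (n : ℕ) := cycleGraph 4 □ pathGraph n

open Classical in
/-- vertical part of the encoding -/
noncomputable def vc {n : ℕ} (M : (G n).Subgraph) : Fin (n + 1) → St := fun j v =>
  decide (∃ a b : Fin n, a.val + 1 = j.val ∧ b.val = j.val ∧ M.Adj (v, a) (v, b))

open Classical in
/-- horizontal part of the encoding -/
noncomputable def hc {n : ℕ} (M : (G n).Subgraph) : Fin n → St := fun i v =>
  decide (M.Adj (v, i) (v + 1, i))

lemma vc_zero {n : ℕ} (M : (G n).Subgraph) : vc M 0 = fun _ => false := by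
  funext v
  simp [vc]

lemma vc_last {n : ℕ} (M : (G n).Subgraph) : vc M (Fin.last n) = fun _ => false := by
  funext v
  simp only [vc, decide_eq_false_iff_not]
  rintro ⟨a, b, h1, h2, h3⟩
  have := b.2
  simp at h2
  omega

lemma adj_eq {n : ℕ} (M : (G n).Subgraph) (a b : Fin 4 × Fin n) :
    M.Adj a b ↔ R (vc M) (hc M) a b := by
  obtain ⟨v, i⟩ := a
  obtain ⟨w, j⟩ := b
  constructor
  · intro hM
    have hG := (adj_iff _ _).1 (M.adj_sub hM)
    simp only at hG
    rcases hG with ⟨rfl, rfl | rfl⟩ | ⟨rfl, h | h⟩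
    · left
      refine ⟨rfl, Or.inl ⟨rfl, ?_⟩⟩
      simpa [hc] using hM
    · left
      refine ⟨rfl, Or.inr ⟨rfl, ?_⟩⟩
      simpa [hc] using hM.symm
    · right
      refine ⟨rfl, Or.inl ⟨h, ?_⟩⟩
      simp only [vc, decide_eq_true_eq]
      exact ⟨i, j, h, rfl, hM⟩
    · right
      refine ⟨rfl, Or.inr ⟨h, ?_⟩⟩
      simp only [vc, decide_eq_true_eq]
      exact ⟨j, i, h, rfl, hM.symm⟩
  · rintro (⟨h0, ⟨h1, h⟩ | ⟨h1, h⟩⟩ | ⟨h0, ⟨h1, h⟩ | ⟨h1, h⟩⟩)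
    · simp only at h0 h1 h
      subst h0 h1
      simpa [hc] using h
    · simp only at h0 h1 h
      subst h0 h1
      simpa [hc] using (show M.Adj _ _ by simpa [hc] using h).symm
    · simp only at h0 h1 h
      subst h0
      simp only [vc, decide_eq_true_eq] at h
      obtain ⟨a, b, e1, e2, e3⟩ := h
      obtain rfl : b = j := Fin.ext e2
      obtain rfl : a = i := Fin.ext (by simp at e1; omega)
      exact e3
    · simp only at h0 h1 h
      subst h0
      simp only [vc, decide_eq_true_eq] at h
      obtain ⟨a, b, e1, e2, e3⟩ := h
      obtain rfl : b = i := Fin.ext e2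
      obtain rfl : a = j := Fin.ext (by simp at e1; omega)
      exact e3.symm

lemma R_symm {n : ℕ} (c : Fin (n + 1) → St) (h : Fin n → St) (a b : Fin 4 × Fin n)
    (hR : R c h a b) : R c h b a := by
  obtain ⟨v, i⟩ := a
  obtain ⟨w, j⟩ := b
  unfold R at *
  simp only at *
  rcases hR with ⟨rfl, hh⟩ | ⟨rfl, hh⟩
  · exact Or.inl ⟨rfl, hh.symm⟩
  · exact Or.inr ⟨rfl, hh.symm⟩

/-- The subgraph of an encoding. -/
def sub {n : ℕ} (c : Fin (n + 1) → St) (h : Fin n → St) : (G n).Subgraph where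
  verts := Set.univ
  Adj := R c h
  adj_sub := by
    intro a b hR
    rw [adj_iff]
    unfold R at hR
    tauto
  edge_vert := fun _ => Set.mem_univ _
  symm := ⟨R_symm c h⟩

lemma hc_sub {n : ℕ} (c : Fin (n + 1) → St) (h : Fin n → St) : hc (sub c h) = h := by
  funext i v
  rw [Bool.eq_iff_iff]
  have h1 : v ≠ v + 1 + 1 := by revert v; decide
  have h2 : v ≠ v + 1 := by revert v; decide
  simp only [hc, sub, R, decide_eq_true_eq]
  tauto

lemma vc_sub {n : ℕ} (c : Fin (n + 1) → St) (h : Fin n → St) 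
    (h0 : c 0 = fun _ => false) (hl : c (Fin.last n) = fun _ => false) : vc (sub c h) = c := by
  funext j v
  rw [Bool.eq_iff_iff]
  simp only [vc, decide_eq_true_eq]
  simp only [sub]
  constructor
  · rintro ⟨a, b, h1, h2, h3⟩
    have hb : b.castSucc = j := Fin.ext h2
    rcases h3 with ⟨e, -⟩ | ⟨-, ⟨-, e⟩ | ⟨e, -⟩⟩
    · simp only at e
      subst e
      omega
    · rwa [hb] at e
    · simp only at e
      omega
  · intro hc
    have hj0 : j.val ≠ 0 := fun h => by
      have : j = 0 := Fin.ext h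
      rw [this, h0] at hc
      simp at hc
    have hjn : j.val ≠ n := fun h => by
      have : j = Fin.last n := Fin.ext h
      rw [this, hl] at hc
      simp at hc
    have := j.2
    refine ⟨⟨j.val - 1, by omega⟩, ⟨j.val, by omega⟩, by simp only; omega, rfl, ?_⟩
    right
    refine ⟨rfl, Or.inl ⟨by simp only; omega, ?_⟩⟩
    exact hc

lemma pm_iff {n : ℕ} (M : (G n).Subgraph) : M.IsPerfectMatching ↔
    ∀ i : Fin n, ok (vc M i.castSucc) (vc M i.succ) (hc M i) := by
  rw [Subgraph.isPerfectMatching_iff]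
  simp only [adj_eq]
  constructor
  · intro h i v
    exact (key _ _ (vc_zero M) (vc_last M) v i).1 (h (v, i))
  · rintro h ⟨v, i⟩
    exact (key _ _ (vc_zero M) (vc_last M) v i).2 (h i v)

/-- Perfect matchings correspond to encodings. -/
noncomputable def pmEquiv (n : ℕ) : {M : (G n).Subgraph | M.IsPerfectMatching} ≃ Q n E0 where
  toFun M := ⟨(vc M.1, hc M.1), vc_zero _, vc_last _, (pm_iff M.1).1 M.2⟩
  invFun q := ⟨sub q.1.1 q.1.2, by
    obtain ⟨⟨c, h⟩, h0, hl, hk⟩ := q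
    change (sub c h).IsPerfectMatching
    rw [pm_iff, vc_sub c h h0 hl, hc_sub]
    exact hk⟩
  left_inv M := by
    apply Subtype.ext
    refine Subgraph.ext ?_ ?_
    · exact (Subgraph.isSpanning_iff.1 M.2.2).symm
    · funext a b
      exact propext (adj_eq M.1 a b).symm
  right_inv q := by
    obtain ⟨⟨c, h⟩, h0, hl, hk⟩ := q
    apply Subtype.ext
    exact Prod.ext (vc_sub c h h0 hl) (hc_sub c h)

end PmAux

/-- The number of perfect matchings of `C_4 × P_n` (the `2×2×n` cubic lattice)
equals `∏_{k=1}^n (2 + 4 cos²(kπ/(n+1)))`. -/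
theorem pm_c4_boxProd_path (n : ℕ) (hn : 0 < n) :
    (Pm (cycleGraph 4 □ pathGraph n) : ℝ) =
      ∏ k ∈ Finset.Icc 1 n, (2 + 4 * Real.cos (k * Real.pi / (n + 1)) ^ 2) := by
  rw [← PmAux.W_real]
  congr 1
  unfold Pm PmAux.W
  rw [← Nat.card_eq_fintype_card, ← Nat.card_congr (PmAux.pmEquiv n)]
  rfl
end

section
/- Let T be a tree. Then the number of perfect matchings of C_4 × T is a perfect square or twice a perfect square; that is, there exists a natural number m such that Pm(C_4 × T) = m² or Pm(C_4 × T) = 2m². -/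
open SimpleGraph

namespace C4Tree

/-- weights on subsets of `Fin 4` -/
def al (S : Finset (Fin 4)) : ℕ := if S = ∅ then 1 else 0
def be (S : Finset (Fin 4)) : ℕ :=
  if S = {0, 1} ∨ S = {1, 2} ∨ S = {2, 3} ∨ S = {0, 3} then 1 else 0
def ga (S : Finset (Fin 4)) : ℕ := if S = Finset.univ then 1 else 0

def mk (a b c : ℕ) (S : Finset (Fin 4)) : ℕ := a * al S + b * be S + c * ga S

def conv (f g : Finset (Fin 4) → ℕ) (S : Finset (Fin 4)) : ℕ :=
  ∑ U ∈ Finset.univ.filter (fun U => Disjoint S U), f (S ∪ U) * g U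

lemma conv_aa : ∀ S, conv al al S = al S := by decide +kernel
lemma conv_ab : ∀ S, conv al be S = 0 := by decide +kernel
lemma conv_ac : ∀ S, conv al ga S = 0 := by decide +kernel
lemma conv_ba : ∀ S, conv be al S = be S := by decide +kernel
lemma conv_bb : ∀ S, conv be be S = 4 * al S := by decide +kernel
lemma conv_bc : ∀ S, conv be ga S = 0 := by decide +kernel
lemma conv_ca : ∀ S, conv ga al S = ga S := by decide +kernel
lemma conv_cb : ∀ S, conv ga be S = be S := by decide +kernel
lemma conv_cc : ∀ S, conv ga ga S = al S := by decide +kernel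

lemma conv_mk (a b c a' b' c' : ℕ) (S : Finset (Fin 4)) :
    conv (mk a b c) (mk a' b' c') S
      = mk (a * a' + 4 * b * b' + c * c') (b * a' + c * b') (c * a') S := by
  have h : conv (mk a b c) (mk a' b' c') S =
      a * a' * conv al al S + a * b' * conv al be S + a * c' * conv al ga S
      + b * a' * conv be al S + b * b' * conv be be S + b * c' * conv be ga S
      + c * a' * conv ga al S + c * b' * conv ga be S + c * c' * conv ga ga S := by
    simp only [conv, mk, Finset.mul_sum, ← Finset.sum_add_distrib]
    refine Finset.sum_congr rfl fun U _ => ?_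
    ring
  rw [h, conv_aa, conv_ab, conv_ac, conv_ba, conv_bb, conv_bc, conv_ca, conv_cb, conv_cc]
  simp only [mk]; ring

def Sq (n : ℕ) : Prop := ∃ m : ℕ, n = m ^ 2 ∨ n = 2 * m ^ 2

lemma Sq.mul {x y : ℕ} (hx : Sq x) (hy : Sq y) : Sq (x * y) := by
  obtain ⟨m, rfl | rfl⟩ := hx <;> obtain ⟨n, rfl | rfl⟩ := hy
  · exact ⟨m * n, Or.inl (by ring)⟩
  · exact ⟨m * n, Or.inr (by ring)⟩
  · exact ⟨m * n, Or.inr (by ring)⟩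
  · exact ⟨2 * m * n, Or.inl (by ring)⟩

lemma sq_of_mul_sq {a n k : ℕ} (hn : 0 < n) (h : a * n ^ 2 = k ^ 2) : ∃ m, a = m ^ 2 := by
  have : n ^ 2 ∣ k ^ 2 := ⟨a, by rw [← h]; ring⟩
  rw [Nat.pow_dvd_pow_iff (by norm_num)] at this
  obtain ⟨t, rfl⟩ := this
  refine ⟨t, ?_⟩
  have : n ^ 2 * a = n ^ 2 * t ^ 2 := by rw [mul_comm, h]; ring
  exact Nat.eq_of_mul_eq_mul_left (by positivity) this

lemma Sq.of {a b c : ℕ} (hc : Sq c) (h0 : 0 < c) (h : a * c = 2 * b ^ 2) : Sq a := by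
  obtain ⟨n, rfl | rfl⟩ := hc
  · have hn : 0 < n := Nat.pos_of_ne_zero (by rintro rfl; simp at h0)
    obtain ⟨m, hm⟩ := sq_of_mul_sq (a := 2 * a) (n := n) (k := 2 * b) hn (by nlinarith)
    have h2 : 2 ∣ m := by
      have : 2 ∣ m ^ 2 := ⟨a, hm.symm⟩
      exact Nat.prime_two.dvd_of_dvd_pow this
    obtain ⟨t, rfl⟩ := h2
    exact ⟨t, Or.inr (by nlinarith)⟩
  · have hn : 0 < n := Nat.pos_of_ne_zero (by rintro rfl; simp at h0)
    obtain ⟨m, hm⟩ := sq_of_mul_sq (a := a) (n := n) (k := b) hn (by nlinarith)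
    exact ⟨m, Or.inl hm⟩

/-- The invariant class of vertex weights. -/
def Nice (w : Finset (Fin 4) → ℕ) : Prop :=
  ∃ a b c : ℕ, 0 < a ∧ 0 < c ∧ Sq c ∧ a * c = 2 * b ^ 2 ∧ w = mk a b c

lemma Nice.conv {f g : Finset (Fin 4) → ℕ} (hf : Nice f) (hg : Nice g) : Nice (conv f g) := by
  obtain ⟨a, b, c, ha, hc, hs, h, rfl⟩ := hf
  obtain ⟨a', b', c', ha', hc', hs', h', rfl⟩ := hg
  refine ⟨_, _, _, ?_, ?_, ?_, ?_, funext fun S => conv_mk a b c a' b' c' S⟩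
  · positivity
  · positivity
  · exact hs.mul (hs'.of hc' h')
  · have e1 : (a * a' + 4 * b * b' + c * c') * (c * a')
      = (a * c) * a' ^ 2 + 4 * b * b' * c * a' + c ^ 2 * (a' * c') := by ring
    rw [e1, h, h']; ring

lemma Nice.sq {f : Finset (Fin 4) → ℕ} (hf : Nice f) : Sq (f ∅) := by
  obtain ⟨a, b, c, ha, hc, hs, h, rfl⟩ := hf
  have : mk a b c ∅ = a := by
    simp [mk, show al ∅ = 1 by decide, show be ∅ = 0 by decide, show ga ∅ = 0 by decide]
  rw [this]; exact hs.of hc h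

section
variable {V : Type*} [Fintype V] [DecidableEq V] (T : SimpleGraph V)

open Classical in
/-- Configurations of vertical edges inside `s`. -/
noncomputable def Conf (s : Finset V) : Finset (Fin 4 → Equiv.Perm V) :=
  Finset.univ.filter fun g => ∀ i, (∀ v, v ∉ s → g i v = v) ∧
    ∀ v, g i (g i v) = v ∧ (g i v = v ∨ T.Adj v (g i v))

def supp (g : Fin 4 → Equiv.Perm V) (v : V) : Finset (Fin 4) :=
  Finset.univ.filter fun i => g i v ≠ v

noncomputable def Z (s : Finset V) (w : V → Finset (Fin 4) → ℕ) : ℕ :=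
  ∑ g ∈ Conf T s, ∏ v ∈ s, w v (supp g v)

def glue (l p : V) (U : Finset (Fin 4)) (g : Fin 4 → Equiv.Perm V) : Fin 4 → Equiv.Perm V :=
  fun i => if i ∈ U then g i * Equiv.swap l p else g i

variable {T}

lemma mem_supp {g : Fin 4 → Equiv.Perm V} {v : V} {i : Fin 4} : i ∈ supp g v ↔ g i v ≠ v := by
  simp [supp]

lemma mem_Conf {s : Finset V} {g : Fin 4 → Equiv.Perm V} : g ∈ Conf T s ↔
    ∀ i, (∀ v, v ∉ s → g i v = v) ∧ ∀ v, g i (g i v) = v ∧ (g i v = v ∨ T.Adj v (g i v)) := by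
  simp [Conf]

lemma Z_insert {s : Finset V} {l p : V} (hl : l ∉ s) (hp : p ∈ s) (hlp : T.Adj l p)
    (huniq : ∀ q ∈ s, T.Adj l q → q = p) (w : V → Finset (Fin 4) → ℕ) :
    Z T (insert l s) w = Z T s (Function.update w p (conv (w p) (w l))) := by
  have hne : l ≠ p := hlp.ne
  have hprod : ∀ g ∈ Conf T s,
      ∏ v ∈ s, (Function.update w p (conv (w p) (w l))) v (supp g v)
      = ∑ U ∈ Finset.univ.filter (fun U => Disjoint (supp g p) U),
          w l U * (w p (supp g p ∪ U) * ∏ v ∈ s.erase p, w v (supp g v)) := by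
    intro g hg
    rw [← Finset.mul_prod_erase s _ hp, Function.update_self, show ∀ S, conv (w p) (w l) S = ∑ U ∈ Finset.univ.filter (fun U => Disjoint S U),
      w p (S ∪ U) * w l U from fun _ => rfl, Finset.sum_mul]
    refine Finset.sum_congr rfl fun U _ => ?_
    have : ∏ v ∈ s.erase p, (Function.update w p (conv (w p) (w l))) v (supp g v)
        = ∏ v ∈ s.erase p, w v (supp g v) := by
      refine Finset.prod_congr rfl fun v hv => ?_
      rw [Function.update_of_ne (Finset.ne_of_mem_erase hv)]
    rw [this]; ring
  unfold Z
  rw [Finset.sum_congr rfl hprod, Finset.sum_sigma']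
  have key : ∀ g ∈ Conf T (insert l s), ∀ i, g i l = l ∨ g i l = p := by
    intro g hg i
    rw [mem_Conf] at hg
    rcases ((hg i).2 l).2 with h | h
    · exact Or.inl h
    · right
      apply huniq _ _ h
      by_contra hc
      have h1 : g i l ∉ insert l s := by
        simp only [Finset.mem_insert, not_or]; exact ⟨h.ne', hc⟩
      have h2 := (hg i).1 _ h1
      rw [((hg i).2 l).1] at h2
      exact h.ne h2
  symm
  refine Finset.sum_bij' (fun x _ => glue l p x.2 x.1)
    (fun g _ => ⟨glue l p (supp g l) g, supp g l⟩) ?_ ?_ ?_ ?_ ?_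
  · rintro ⟨g, U⟩ h
    simp only [Finset.mem_sigma, Finset.mem_filter, Finset.mem_univ, true_and] at h
    obtain ⟨hg, hU⟩ := h
    rw [mem_Conf] at hg ⊢
    intro i
    simp only [glue]
    split_ifs with hi
    · have hpi : g i p = p := by
        by_contra hc
        exact Finset.disjoint_right.1 hU hi (by simp [mem_supp, hc])
      have hli : g i l = l := (hg i).1 l hl
      refine ⟨fun v hv => ?_, fun v => ?_⟩
      · simp only [Finset.mem_insert, not_or] at hv
        have : v ≠ p := by rintro rfl; exact hv.2 hp
        simp [Equiv.swap_apply_of_ne_of_ne hv.1 this, (hg i).1 v hv.2]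
      · by_cases h1 : v = l
        · subst h1; simp [hpi, hli, hlp]
        by_cases h2 : v = p
        · subst h2; simp [hpi, hli, hlp.symm]
        have h3 : g i v ≠ l := fun h => h1 (by rw [← hli] at h; exact (g i).injective h)
        have h4 : g i v ≠ p := fun h => h2 (by rw [← hpi] at h; exact (g i).injective h)
        simp only [Equiv.Perm.mul_apply, Equiv.swap_apply_of_ne_of_ne h1 h2,
          Equiv.swap_apply_of_ne_of_ne h3 h4]
        exact (hg i).2 v
    · exact ⟨fun v hv => (hg i).1 v (fun h => hv (Finset.mem_insert_of_mem h)), (hg i).2⟩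
  · intro g hg
    have k := key g hg
    rw [mem_Conf] at hg
    simp only [Finset.mem_sigma, Finset.mem_filter, Finset.mem_univ, true_and]
    constructor
    · rw [mem_Conf]
      intro i
      simp only [glue]
      split_ifs with hi
      · have hli : g i l = p := (k i).resolve_left (by simpa [mem_supp] using hi)
        have hpi : g i p = l := by rw [← hli]; exact ((hg i).2 l).1
        refine ⟨fun v hv => ?_, fun v => ?_⟩
        · by_cases h1 : v = l
          · subst h1; simp [hpi]
          have : v ≠ p := by rintro rfl; exact hv hp
          simp [Equiv.swap_apply_of_ne_of_ne h1 this, (hg i).1 v (by simp [h1, hv])]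
        · by_cases h1 : v = l
          · subst h1; simp [hpi]
          by_cases h2 : v = p
          · subst h2; simp [hli]
          have h3 : g i v ≠ l := fun h => h2 (by rw [← hpi] at h; exact (g i).injective h)
          have h4 : g i v ≠ p := fun h => h1 (by rw [← hli] at h; exact (g i).injective h)
          simp only [Equiv.Perm.mul_apply, Equiv.swap_apply_of_ne_of_ne h1 h2,
            Equiv.swap_apply_of_ne_of_ne h3 h4]
          exact (hg i).2 v
      · have hli : g i l = l := by simpa [mem_supp] using hi
        refine ⟨fun v hv => ?_, (hg i).2⟩
        by_cases h1 : v = l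
        · rw [h1, hli]
        · exact (hg i).1 v (by simp [h1, hv])
    · rw [Finset.disjoint_right]
      intro i hi
      have hli : g i l = p := (k i).resolve_left (by simpa [mem_supp] using hi)
      simp [mem_supp, glue, hli, hne.symm]
  · rintro ⟨g, U⟩ h
    simp only [Finset.mem_sigma, Finset.mem_filter, Finset.mem_univ, true_and] at h
    obtain ⟨hg, hU⟩ := h
    rw [mem_Conf] at hg
    have hS : supp (glue l p U g) l = U := by
      ext i
      have hli : g i l = l := (hg i).1 l hl
      by_cases hi : i ∈ U
      · have hpi : g i p = p := by
          by_contra hc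
          exact Finset.disjoint_right.1 hU hi (by simp [mem_supp, hc])
        simp [mem_supp, glue, hi, hpi, hne.symm]
      · simp [mem_supp, glue, hi, hli]
    have hG : glue l p U (glue l p U g) = g := by
      funext i
      by_cases hi : i ∈ U <;> simp [glue, hi, mul_assoc]
    simp only [hS, hG]
  · intro g hg
    funext i
    by_cases hi : i ∈ supp g l <;> simp [glue, hi, mul_assoc]
  · rintro ⟨g, U⟩ h
    simp only [Finset.mem_sigma, Finset.mem_filter, Finset.mem_univ, true_and] at h
    obtain ⟨hg, hU⟩ := h
    rw [mem_Conf] at hg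
    have hpU : ∀ i ∈ U, g i p = p := by
      intro i hi
      by_contra hc
      exact Finset.disjoint_right.1 hU hi (by simp [mem_supp, hc])
    have hl' : supp (glue l p U g) l = U := by
      ext i
      have hli : g i l = l := (hg i).1 l hl
      by_cases hi : i ∈ U
      · simp [mem_supp, glue, hi, hpU i hi, hne.symm]
      · simp [mem_supp, glue, hi, hli]
    have hp' : supp (glue l p U g) p = supp g p ∪ U := by
      ext i
      have hli : g i l = l := (hg i).1 l hl
      by_cases hi : i ∈ U
      · simp [mem_supp, glue, hi, hli, hne]
      · simp [mem_supp, glue, hi]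
    rw [Finset.prod_insert hl, ← Finset.mul_prod_erase s _ hp]
    simp only [hl', hp']
    congr 2
    refine Finset.prod_congr rfl fun v hv => ?_
    congr 1
    have h1 : v ≠ p := Finset.ne_of_mem_erase hv
    have h2 : v ≠ l := by rintro rfl; exact hl (Finset.mem_of_mem_erase hv)
    ext i
    by_cases hi : i ∈ U <;> simp [mem_supp, glue, hi, Equiv.swap_apply_of_ne_of_ne h2 h1]

lemma Z_singleton (r : V) (w : V → Finset (Fin 4) → ℕ) : Z T {r} w = w r ∅ := by
  have : Conf T {r} = {fun _ => 1} := by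
    ext g
    rw [mem_Conf, Finset.mem_singleton]
    constructor
    · intro h
      funext i
      ext v
      have h1 := (h i).1
      by_cases hv : v = r
      · subst hv
        by_contra hc
        have hc' : g i v ≠ v := hc
        have h2 := h1 (g i v) (by simpa using hc')
        rw [((h i).2 v).1] at h2
        exact hc' h2.symm
      · exact h1 v (by simpa using hv)
    · rintro rfl i
      simp
  simp [Z, this, supp]

/-- Sets reachable by attaching leaves. -/
inductive Good (T : SimpleGraph V) : Finset V → Prop
  | single (r : V) : Good T {r}
  | attach (s : Finset V) (l p : V) (hs : Good T s) (hl : l ∉ s) (hp : p ∈ s)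
      (hlp : T.Adj l p) (hu : ∀ q ∈ s, T.Adj l q → q = p) : Good T (insert l s)

lemma Good.sq {s : Finset V} (h : Good T s) :
    ∀ w : V → Finset (Fin 4) → ℕ, (∀ v, Nice (w v)) → Sq (Z T s w) := by
  induction h with
  | single r => intro w hw; rw [Z_singleton]; exact (hw r).sq
  | attach s l p hs hl hp hlp hu ih =>
    intro w hw
    rw [Z_insert hl hp hlp hu]
    apply ih
    intro v
    by_cases hv : v = p
    · subst hv; rw [Function.update_self]; exact (hw _).conv (hw _)
    · rw [Function.update_of_ne hv]; exact hw v

lemma Good.walk {s : Finset V} (h : Good T s) :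
    ∀ p ∈ s, ∀ q ∈ s, ∃ w : T.Walk p q, ∀ x ∈ w.support, x ∈ s := by
  induction h with
  | single r =>
    intro p hp q hq
    rw [Finset.mem_singleton] at hp hq
    subst hp; subst hq
    exact ⟨.nil, by simp⟩
  | attach s l p hs hl hp hlp hu ih =>
    have main : ∀ q ∈ s, ∃ w : T.Walk l q, ∀ x ∈ w.support, x ∈ insert l s := by
      intro q hq
      obtain ⟨w, hw⟩ := ih p hp q hq
      refine ⟨.cons hlp w, ?_⟩
      intro x hx
      rw [Walk.support_cons, List.mem_cons] at hx
      rcases hx with rfl | hx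
      · simp
      · exact Finset.mem_insert_of_mem (hw x hx)
    intro a ha b hb
    rw [Finset.mem_insert] at ha hb
    rcases ha with rfl | ha <;> rcases hb with rfl | hb
    · exact ⟨.nil, by simp⟩
    · exact main b hb
    · obtain ⟨w, hw⟩ := main a ha
      exact ⟨w.reverse, by simpa using hw⟩
    · obtain ⟨w, hw⟩ := ih a ha b hb
      exact ⟨w, fun x hx => Finset.mem_insert_of_mem (hw x hx)⟩

lemma Good.nonempty {s : Finset V} (h : Good T s) : s.Nonempty := by
  cases h <;> simp

lemma good_step (hT : T.IsTree) {s : Finset V} (h : Good T s) (hs : s ≠ Finset.univ) :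
    ∃ l, l ∉ s ∧ Good T (insert l s) := by
  obtain ⟨r, hr⟩ := h.nonempty
  obtain ⟨x, hx⟩ : ∃ x, x ∉ s := by
    by_contra hc; push Not at hc; exact hs (Finset.eq_univ_iff_forall.2 hc)
  obtain ⟨W⟩ := hT.connected.preconnected r x
  obtain ⟨d, hd, h1, h2⟩ := W.exists_boundary_dart (s : Set V) (by simpa using hr) (by simpa using hx)
  rw [Finset.mem_coe] at h1 h2
  refine ⟨d.snd, h2, Good.attach s d.snd d.fst h h2 h1 d.adj.symm ?_⟩
  intro q hq hadj
  by_contra hne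
  obtain ⟨w, hw⟩ := h.walk d.fst h1 q hq
  have p2 : (Walk.cons d.adj (Walk.cons hadj Walk.nil)).IsPath := by
    simp [Walk.cons_isPath_iff, hadj.ne, d.adj.ne, Ne.symm hne]
  have := hT.isAcyclic.path_unique ⟨w.bypass, w.bypass_isPath⟩ ⟨_, p2⟩
  have e : w.bypass = Walk.cons d.adj (Walk.cons hadj Walk.nil) := congrArg Subtype.val this
  apply h2
  apply hw
  apply w.support_bypass_subset_support
  rw [e]; simp

lemma good_univ (hT : T.IsTree) : Good T Finset.univ := by
  have : ∀ n (s : Finset V), Good T s → Fintype.card V - s.card = n → Good T Finset.univ := by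
    intro n
    induction n with
    | zero =>
      intro s hs h
      have : s = Finset.univ := by
        rw [← Finset.card_eq_iff_eq_univ]
        have := s.card_le_univ
        omega
      rwa [← this]
    | succ n ih =>
      intro s hs h
      have hne : s ≠ Finset.univ := by
        rintro rfl; simp at h
      obtain ⟨l, hl, hg⟩ := good_step hT hs hne
      refine ih _ hg ?_
      rw [Finset.card_insert_of_notMem hl]; omega
  obtain ⟨r⟩ := hT.connected.nonempty
  exact this _ _ (Good.single r) rfl

/-- perfect matchings of the four-cycle minus `S` -/
def Cyc (S : Finset (Fin 4)) : Finset (Fin 4 → Fin 4) :=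
  Finset.univ.filter fun t => (∀ i, t (t i) = i) ∧ (∀ i, i ∈ S → t i = i) ∧
    ∀ i, i ∉ S → (t i = i + 1 ∨ i = t i + 1)

lemma card_Cyc : ∀ S, (Cyc S).card = mk 2 1 1 S := by decide +kernel

lemma c4adj : ∀ i j : Fin 4, (cycleGraph 4).Adj i j ↔ (j = i + 1 ∨ i = j + 1) := by decide

lemma nice_base : Nice (fun S => (Cyc S).card) :=
  ⟨2, 1, 1, by norm_num, by norm_num, ⟨1, by norm_num⟩, by norm_num, funext card_Cyc⟩

/-- all data -/
noncomputable def Data (T : SimpleGraph V) :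
    Finset (Σ _ : (Fin 4 → Equiv.Perm V), V → Fin 4 → Fin 4) :=
  (Conf T Finset.univ).sigma fun g => Fintype.piFinset fun v => Cyc (supp g v)

lemma card_Data : (Data T).card = Z T Finset.univ (fun _ S => (Cyc S).card) := by
  simp [Data, Z, Finset.card_sigma, Fintype.card_piFinset]

lemma mem_Data {x : Σ _ : (Fin 4 → Equiv.Perm V), V → Fin 4 → Fin 4} : x ∈ Data T ↔
    (∀ i v, x.1 i (x.1 i v) = v) ∧ (∀ i v, x.1 i v = v ∨ T.Adj v (x.1 i v)) ∧
    (∀ v i, x.2 v (x.2 v i) = i) ∧ (∀ v i, x.1 i v ≠ v → x.2 v i = i) ∧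
    (∀ v i, x.1 i v = v → (cycleGraph 4).Adj i (x.2 v i)) := by
  simp only [Data, Finset.mem_sigma, mem_Conf, Fintype.mem_piFinset, Cyc, supp,
    Finset.mem_filter, Finset.mem_univ, true_and, c4adj, not_not, not_true_eq_false,
    false_imp_iff, implies_true]
  constructor
  · rintro ⟨h1, h2⟩
    exact ⟨fun i v => (h1 i v).1, fun i v => (h1 i v).2, fun v => (h2 v).1,
      fun v => (h2 v).2.1, fun v => (h2 v).2.2⟩
  · rintro ⟨h1, h2, h3, h4, h5⟩
    exact ⟨fun i v => ⟨h1 i v, h2 i v⟩, fun v => ⟨h3 v, h4 v, h5 v⟩⟩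

/-- The subgraph given by an involution. -/
def ofInv {W : Type*} (G : SimpleGraph W) (f : W → W) (h1 : ∀ x, f (f x) = x)
    (h2 : ∀ x, G.Adj x (f x)) : G.Subgraph where
  verts := Set.univ
  Adj x y := f x = y
  adj_sub := by rintro x y rfl; exact h2 x
  edge_vert := by intros; trivial
  symm := ⟨by rintro x y rfl; exact h1 x⟩

lemma Pm_eq {W : Type*} (G : SimpleGraph W) :
    Pm G = Set.ncard {f : W → W | (∀ x, f (f x) = x) ∧ ∀ x, G.Adj x (f x)} := by
  unfold Pm
  symm
  refine Set.ncard_congr (fun f hf => ofInv G f hf.1 hf.2) ?_ ?_ ?_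
  · rintro f ⟨h1, h2⟩
    rw [Set.mem_setOf_eq, Subgraph.isPerfectMatching_iff]
    intro v
    exact ⟨f v, rfl, fun y hy => Eq.symm hy⟩
  · intro f g hf hg h
    funext x
    have : (ofInv G f hf.1 hf.2).Adj x (f x) := rfl
    rw [h] at this
    exact Eq.symm this
  · intro M hM
    rw [Set.mem_setOf_eq, Subgraph.isPerfectMatching_iff] at hM
    choose f hf hu using hM
    refine ⟨f, ⟨fun x => (hu (f x) x (hf x).symm).symm, fun x => (hf x).adj_sub⟩, ?_⟩
    ext x y
    · simp only [ofInv, Set.mem_univ, true_iff]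
      exact M.edge_vert (hf x)
    · constructor
      · rintro rfl; exact hf x
      · intro h; exact (hu x y h).symm

lemma Pm_box : Pm (cycleGraph 4 □ T) = (Data T).card := by
  rw [Pm_eq, ← Set.ncard_coe_finset]
  symm
  refine Set.ncard_congr (fun x _ => fun y => (x.2 y.2 y.1, x.1 y.1 y.2)) ?_ ?_ ?_
  · rintro ⟨g, t⟩ h
    rw [Finset.mem_coe, mem_Data] at h
    obtain ⟨h1, h2, h3, h4, h5⟩ := h
    dsimp only at h1 h2 h3 h4 h5
    refine ⟨?_, ?_⟩
    · rintro ⟨i, v⟩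
      by_cases hv : g i v = v
      · have : g (t v i) v = v := by
          by_contra hc
          have := h4 v _ hc
          rw [h3] at this
          exact (h5 v i hv).ne this
        simp [hv, h3, this]
      · simp [h4 v i hv, h1]
        apply h4
        rw [h1]; exact fun h => hv h.symm
    · rintro ⟨i, v⟩
      rw [boxProd_adj]
      by_cases hv : g i v = v
      · left; exact ⟨h5 v i hv, hv.symm⟩
      · right; exact ⟨(h2 i v).resolve_left hv, (h4 v i hv).symm⟩
  · rintro ⟨g, t⟩ ⟨g', t'⟩ _ _ h
    have h' : ∀ i v, t v i = t' v i ∧ g i v = g' i v := fun i v => by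
      have := congrFun h (i, v)
      simpa using this
    have e1 : g = g' := by funext i; ext v; exact (h' i v).2
    have e2 : t = t' := by funext v i; exact (h' i v).1
    rw [e1, e2]
  · rintro f ⟨h1, h2⟩
    have h2' : ∀ i v, ((cycleGraph 4).Adj i (f (i, v)).1 ∧ (f (i, v)).2 = v) ∨
        (T.Adj v (f (i, v)).2 ∧ (f (i, v)).1 = i) := by
      intro i v
      have := h2 (i, v)
      rw [boxProd_adj] at this
      simpa [eq_comm] using this
    have hinv : ∀ i v, (f (i, (f (i, v)).2)).2 = v := by
      intro i v
      rcases h2' i v with ⟨_, h⟩ | ⟨_, h⟩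
      · rw [h, h]
      · have : (i, (f (i, v)).2) = f (i, v) := Prod.ext h.symm rfl
        rw [this, h1]
    have hinv' : ∀ i v, (f ((f (i, v)).1, v)).1 = i := by
      intro i v
      rcases h2' i v with ⟨_, h⟩ | ⟨_, h⟩
      · have : ((f (i, v)).1, v) = f (i, v) := Prod.ext rfl h.symm
        rw [this, h1]
      · rw [h, h]
    refine ⟨⟨fun i => ⟨fun v => (f (i, v)).2, fun v => (f (i, v)).2, hinv i, hinv i⟩,
      fun v i => (f (i, v)).1⟩, ?_, ?_⟩
    · rw [Finset.mem_coe, mem_Data]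
      refine ⟨hinv, fun i v => ?_, fun v i => hinv' i v, fun v i => ?_, fun v i => ?_⟩
      · exact (h2' i v).elim (fun h => Or.inl h.2) (fun h => Or.inr h.1)
      · intro h
        exact ((h2' i v).resolve_left fun h' => h h'.2).2
      · intro h
        exact ((h2' i v).resolve_right fun h' => h'.1.ne h.symm).1
    · rfl

end

end C4Tree

/-- For a tree `T`, the number of perfect matchings of `C_4 × T` is a perfect
square or twice a perfect square. -/
theorem pm_c4_boxProd_tree_squarish {V : Type*} [Fintype V]
    (T : SimpleGraph V) (hT : T.IsTree) :
    ∃ m : ℕ, Pm (cycleGraph 4 □ T) = m ^ 2 ∨ Pm (cycleGraph 4 □ T) = 2 * m ^ 2 := by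
  classical
  rw [C4Tree.Pm_box, C4Tree.card_Data]
  exact (C4Tree.good_univ hT).sq _ fun _ => C4Tree.nice_base
end

section
/- Let T be a tree that has a perfect matching. Then the number of perfect matchings of C_4 × T is a perfect square; that is, there exists a natural number m such that Pm(C_4 × T) = m². -/
open SimpleGraph

open Finset in
/-- `base a b c U` is `a` on the empty set, `b` on adjacent pairs of the 4-cycle, `c` on the full
set and zero elsewhere. -/
def base (a b c : ℕ) (U : Finset (Fin 4)) : ℕ :=
  if U = ∅ then a else if U = univ then c else
    if U = {0, 1} ∨ U = {1, 2} ∨ U = {2, 3} ∨ U = {0, 3} then b else 0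

/-- The numbers of pairs used to expand products of `base` functions. -/
lemma base_eq (a b c : ℕ) (U : Finset (Fin 4)) :
    base a b c U = a * base 1 0 0 U + b * base 0 1 0 U + c * base 0 0 1 U := by
  unfold base
  split_ifs <;> simp

lemma base_merge (a b c a' b' c' : ℕ) (U : Finset (Fin 4)) :
    ∑ S ∈ Uᶜ.powerset, base a b c (U ∪ S) * base a' b' c' S =
      base (a * a' + 4 * (b * b') + c * c') (b * a' + c * b') (c * a') U := by
  have key : ∀ U : Finset (Fin 4),
      (∑ S ∈ Uᶜ.powerset, base 1 0 0 (U ∪ S) * base 1 0 0 S = base 1 0 0 U) ∧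
      (∑ S ∈ Uᶜ.powerset, base 1 0 0 (U ∪ S) * base 0 1 0 S = 0) ∧
      (∑ S ∈ Uᶜ.powerset, base 1 0 0 (U ∪ S) * base 0 0 1 S = 0) ∧
      (∑ S ∈ Uᶜ.powerset, base 0 1 0 (U ∪ S) * base 1 0 0 S = base 0 1 0 U) ∧
      (∑ S ∈ Uᶜ.powerset, base 0 1 0 (U ∪ S) * base 0 1 0 S = 4 * base 1 0 0 U) ∧
      (∑ S ∈ Uᶜ.powerset, base 0 1 0 (U ∪ S) * base 0 0 1 S = 0) ∧
      (∑ S ∈ Uᶜ.powerset, base 0 0 1 (U ∪ S) * base 1 0 0 S = base 0 0 1 U) ∧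
      (∑ S ∈ Uᶜ.powerset, base 0 0 1 (U ∪ S) * base 0 1 0 S = base 0 1 0 U) ∧
      (∑ S ∈ Uᶜ.powerset, base 0 0 1 (U ∪ S) * base 0 0 1 S = base 1 0 0 U) := by
    decide +kernel
  obtain ⟨h1, h2, h3, h4, h5, h6, h7, h8, h9⟩ := key U
  have e : ∀ S, base a b c (U ∪ S) * base a' b' c' S =
      a * a' * (base 1 0 0 (U ∪ S) * base 1 0 0 S) + a * b' * (base 1 0 0 (U ∪ S) * base 0 1 0 S)
      + a * c' * (base 1 0 0 (U ∪ S) * base 0 0 1 S)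
      + b * a' * (base 0 1 0 (U ∪ S) * base 1 0 0 S) + b * b' * (base 0 1 0 (U ∪ S) * base 0 1 0 S)
      + b * c' * (base 0 1 0 (U ∪ S) * base 0 0 1 S)
      + c * a' * (base 0 0 1 (U ∪ S) * base 1 0 0 S) + c * b' * (base 0 0 1 (U ∪ S) * base 0 1 0 S)
      + c * c' * (base 0 0 1 (U ∪ S) * base 0 0 1 S) := by
    intro S
    rw [base_eq a b c, base_eq a' b' c']
    ring
  simp only [e, Finset.sum_add_distrib, ← Finset.mul_sum]
  rw [h1, h2, h3, h4, h5, h6, h7, h8, h9, base_eq (_ + _)]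
  ring

/-- Admissible vertex weights, with a parity. -/
def Good (k : ℕ) (w : Finset (Fin 4) → ℕ) : Prop :=
  (Even k ∧ ∃ s t, w = base (s ^ 2) (s * t) (2 * t ^ 2)) ∨
  (Odd k ∧ ∃ s t, w = base (2 * s ^ 2) (s * t) (t ^ 2))

/-- The weight obtained by absorbing a leaf. -/
def absorb (w w' : Finset (Fin 4) → ℕ) (U : Finset (Fin 4)) : ℕ :=
  ∑ S ∈ Uᶜ.powerset, w (U ∪ S) * w' S

lemma Good.absorb {k k' : ℕ} {w w' : Finset (Fin 4) → ℕ} (h : Good k w) (h' : Good k' w') :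
    Good (k + k') (absorb w w') := by
  rcases h with ⟨hk, s, t, rfl⟩ | ⟨hk, s, t, rfl⟩ <;>
  rcases h' with ⟨hk', s', t', rfl⟩ | ⟨hk', s', t', rfl⟩
  · refine Or.inl ⟨hk.add hk', s * s' + 2 * t * t', t * s', ?_⟩
    funext U; rw [_root_.absorb, base_merge]; congr 1 <;> ring
  · refine Or.inr ⟨hk.add_odd hk', s * s' + t * t', 2 * t * s', ?_⟩
    funext U; rw [_root_.absorb, base_merge]; congr 1 <;> ring
  · refine Or.inr ⟨hk.add_even hk', s * s' + t * t', t * s', ?_⟩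
    funext U; rw [_root_.absorb, base_merge]; congr 1 <;> ring
  · refine Or.inl ⟨hk.add_odd hk', 2 * s * s' + t * t', t * s', ?_⟩
    funext U; rw [_root_.absorb, base_merge]; congr 1 <;> ring

lemma good_prod {V : Type*} (k : V → ℕ) (w : V → Finset (Fin 4) → ℕ)
    (h : ∀ x, Good (k x) (w x)) (A : Finset V) :
    (Even (∑ x ∈ A, k x) ∧ ∃ m, ∏ x ∈ A, w x ∅ = m ^ 2) ∨
    (Odd (∑ x ∈ A, k x) ∧ ∃ m, ∏ x ∈ A, w x ∅ = 2 * m ^ 2) := by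
  classical
  induction A using Finset.induction_on with
  | empty => exact Or.inl ⟨by simp, 1, by simp⟩
  | insert a A ha ih =>
    rw [Finset.sum_insert ha, Finset.prod_insert ha]
    rcases h a with ⟨hk, s, t, hw⟩ | ⟨hk, s, t, hw⟩ <;> rcases ih with ⟨hs, m, hm⟩ | ⟨hs, m, hm⟩ <;>
      rw [hm, hw] <;> simp only [base, if_true]
    · exact Or.inl ⟨hk.add hs, s * m, by ring⟩
    · exact Or.inr ⟨hk.add_odd hs, s * m, by ring⟩
    · exact Or.inr ⟨hk.add_even hs, s * m, by ring⟩
    · exact Or.inl ⟨hk.add_odd hs, 2 * s * m, by ring⟩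

/-- Perfect matchings of the 4-cycle minus `U`, as involutions fixing exactly `U`. -/
def cyc (U : Finset (Fin 4)) : Finset (Fin 4 → Fin 4) :=
  Finset.univ.filter fun h => ∀ i, h (h i) = i ∧ if i ∈ U then h i = i else
    (h i = i + 1 ∨ i = h i + 1)

lemma card_cyc : ∀ U, (cyc U).card = base 2 1 1 U := by
  decide +kernel

lemma c4_adj : ∀ i j : Fin 4, (cycleGraph 4).Adj i j ↔ (j = i + 1 ∨ i = j + 1) := by
  decide +kernel

/-- A matching of `T`, as an involution. -/
def IsTM {V : Type*} (T : SimpleGraph V) (m : V → V) : Prop :=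
  ∀ x, m (m x) = x ∧ (m x = x ∨ T.Adj x (m x))

section
open Classical

/-- The vertices copies covered at `x`. -/
noncomputable def cov {V : Type*} (M : Fin 4 → V → V) (x : V) : Finset (Fin 4) :=
  Finset.univ.filter fun i => M i x ≠ x

lemma mem_cov {V : Type*} (M : Fin 4 → V → V) (x : V) (i : Fin 4) : i ∈ cov M x ↔ M i x ≠ x := by
  simp [cov]

/-- Quadruples of matchings of `T`. -/
noncomputable def quad {V : Type*} [Fintype V] (T : SimpleGraph V) : Finset (Fin 4 → V → V) :=
  Finset.univ.filter fun M => ∀ i, IsTM T (M i)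

lemma mem_quad {V : Type*} [Fintype V] (T : SimpleGraph V) (M : Fin 4 → V → V) :
    M ∈ quad T ↔ ∀ i, IsTM T (M i) := by simp [quad]

/-- Weighted count of quadruples of matchings. -/
noncomputable def W {V : Type*} [Fintype V] (T : SimpleGraph V) (w : V → Finset (Fin 4) → ℕ) : ℕ :=
  ∑ M ∈ quad T, ∏ x, w x (cov M x)

lemma exists_leaf {V : Type*} [Fintype V] (T : SimpleGraph V) (hT : T.IsAcyclic) (hne : T ≠ ⊥) :
    ∃ l v, T.Adj l v ∧ ∀ u, T.Adj l u → u = v := by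
  obtain ⟨a, b, hab⟩ := SimpleGraph.ne_bot_iff_exists_adj.mp hne
  have ht := hT.isTree_connectedComponent (T.connectedComponentMk a)
  have hb : b ∈ T.connectedComponentMk a :=
    (SimpleGraph.ConnectedComponent.eq.mpr hab.symm.reachable)
  have ha : a ∈ T.connectedComponentMk a := rfl
  have : Nontrivial (T.connectedComponentMk a) :=
    ⟨⟨a, ha⟩, ⟨b, hb⟩, fun h => hab.ne (congrArg Subtype.val h)⟩
  obtain ⟨l, hl⟩ := ht.exists_vert_degree_one_of_nontrivial
  rw [SimpleGraph.degree_eq_one_iff_existsUnique_adj] at hl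
  obtain ⟨v, hv, hu⟩ := hl
  refine ⟨l.1, v.1, hv, fun u hlu => ?_⟩
  have hu' : u ∈ T.connectedComponentMk a := by
    have := l.2
    exact (SimpleGraph.ConnectedComponent.eq.mpr hlu.symm.reachable).trans this
  exact congrArg Subtype.val (hu ⟨u, hu'⟩ hlu)

/-- Isolating a vertex. -/
def isol {V : Type*} (T : SimpleGraph V) (l : V) : SimpleGraph V where
  Adj x y := T.Adj x y ∧ x ≠ l ∧ y ≠ l
  symm := ⟨fun _ _ h => ⟨h.1.symm, h.2.2, h.2.1⟩⟩
  loopless := ⟨fun x h => T.loopless.irrefl x h.1⟩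

/-- Adding the edge `l v` to the matchings indexed by `S`. -/
noncomputable def addE {V : Type*} (l v : V) (M : Fin 4 → V → V) (S : Finset (Fin 4)) :
    Fin 4 → V → V :=
  fun i x => if i ∈ S then (if x = l then v else if x = v then l else M i x) else M i x

/-- Removing the edge `l v`. -/
noncomputable def delE {V : Type*} (l v : V) (M : Fin 4 → V → V) : Fin 4 → V → V :=
  fun i x => if M i l ≠ l ∧ (x = l ∨ x = v) then x else M i x

lemma W_isol {V : Type*} [Fintype V] (T : SimpleGraph V) (l v : V) (hlv : T.Adj l v)
    (hu : ∀ u, T.Adj l u → u = v) (w : V → Finset (Fin 4) → ℕ) :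
    W T w = W (isol T l)
      (Function.update (Function.update w v (absorb (w v) (w l))) l (base 1 0 0)) := by
  have hne : l ≠ v := hlv.ne
  have split : ∀ f : V → ℕ, ∏ x, f x = f l * (f v * ∏ x ∈ (Finset.univ.erase l).erase v, f x) := by
    intro f
    rw [Finset.mul_prod_erase _ _ (by simp [hne.symm]), Finset.mul_prod_erase _ _ (by simp)]
  have hl : ∀ M ∈ quad (isol T l), ∀ i, M i l = l := by
    intro M hM i
    rcases ((mem_quad _ _).1 hM i l).2 with h | h
    · exact h
    · exact absurd rfl h.2.1
  have rhs : ∀ M ∈ quad (isol T l), ∏ x,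
      (Function.update (Function.update w v (absorb (w v) (w l))) l (base 1 0 0)) x (cov M x) =
      ∑ S ∈ (cov M v)ᶜ.powerset, w l S * (w v (cov M v ∪ S) *
        ∏ x ∈ (Finset.univ.erase l).erase v, w x (cov M x)) := by
    intro M hM
    rw [split]
    have h0 : cov M l = ∅ := by
      ext i; simp [mem_cov, hl M hM i]
    have h1 : ∏ x ∈ (Finset.univ.erase l).erase v, (Function.update
        (Function.update w v (absorb (w v) (w l))) l (base 1 0 0)) x (cov M x) =
        ∏ x ∈ (Finset.univ.erase l).erase v, w x (cov M x) := by
      refine Finset.prod_congr rfl fun x hx => ?_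
      simp only [Finset.mem_erase, Finset.mem_univ, and_true] at hx
      rw [Function.update_of_ne hx.2, Function.update_of_ne hx.1]
    rw [h1, h0]
    simp only [Function.update_self, Function.update_of_ne hne.symm, base, if_true, one_mul, absorb,
      Finset.sum_mul]
    refine Finset.sum_congr rfl fun S _ => ?_
    ring
  rw [W, W, Finset.sum_congr rfl rhs, Finset.sum_sigma']
  refine Finset.sum_bij' (fun M _ => ⟨delE l v M, cov M l⟩) (fun p _ => addE l v p.1 p.2)
    ?_ ?_ ?_ ?_ ?_
  · intro M hM
    rw [mem_quad] at hM
    simp only [Finset.mem_sigma, mem_quad, Finset.mem_powerset]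
    have hml : ∀ i, M i l = l ∨ M i l = v := fun i => ((hM i l).2).imp id (hu _)
    have hmv : ∀ i, M i l = v → M i v = l := fun i h => by rw [← h]; exact (hM i l).1
    refine ⟨fun i x => ?_, fun i hi => ?_⟩
    · have h1 := hM i x
      have h2 := hml i
      have h3 := hmv i
      have h4 := hM i (M i x)
      simp only [delE, isol]
      grind
    · have h2 := hml i
      simp only [Finset.mem_compl, mem_cov, delE] at hi ⊢
      grind
  · rintro ⟨M, S⟩ h
    simp only [Finset.mem_sigma, Finset.mem_powerset] at h
    obtain ⟨hM, hS⟩ := h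
    have hl' := hl M hM
    rw [mem_quad] at hM ⊢
    intro i x
    have h1 := hM i x
    have h2 := hl' i
    have h3 : i ∈ S → M i v = v := fun hi => by simpa [mem_cov] using hS hi
    have h4 := hlv.symm
    simp only [isol] at h1
    simp only [addE]
    grind
  · intro M hM
    rw [mem_quad] at hM
    funext i x
    have h2 : M i l = l ∨ M i l = v := ((hM i l).2).imp id (hu _)
    have h3 : M i l = v → M i v = l := fun h => by rw [← h]; exact (hM i l).1
    simp only [addE, delE, mem_cov]
    grind
  · rintro ⟨M, S⟩ h
    simp only [Finset.mem_sigma, Finset.mem_powerset] at h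
    obtain ⟨hM, hS⟩ := h
    have hl' := hl M hM
    have h3 : ∀ i, i ∈ S → M i v = v := fun i hi => by simpa [mem_cov] using hS hi
    have e1 : delE l v (addE l v M S) = M := by
      funext i x
      have := h3 i
      have := hl' i
      simp only [addE, delE]
      grind
    have e2 : cov (addE l v M S) l = S := by
      ext i
      have := hl' i
      simp only [mem_cov, addE]
      grind
    simp only [e1, e2]
  · intro M hM
    rw [mem_quad] at hM
    have hml : ∀ i, M i l = l ∨ M i l = v := fun i => ((hM i l).2).imp id (hu _)
    have hmv : ∀ i, M i l = v → M i v = l := fun i h => by rw [← h]; exact (hM i l).1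
    rw [split]
    have e1 : cov (delE l v M) v ∪ cov M l = cov M v := by
      ext i
      have := hml i
      have := hmv i
      simp only [Finset.mem_union, mem_cov, delE]
      grind
    simp only [e1]
    congr 2
    refine Finset.prod_congr rfl fun x hx => ?_
    simp only [Finset.mem_erase, Finset.mem_univ, and_true] at hx
    congr 1
    ext i
    simp [mem_cov, delE, hx.1, hx.2]

lemma W_square {V : Type*} [Fintype V] (T : SimpleGraph V) : ∀ (_ : T.IsAcyclic)
    (k : V → ℕ) (w : V → Finset (Fin 4) → ℕ) (_ : ∀ x, Good (k x) (w x)) (_ : Even (∑ x, k x)),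
    ∃ m, W T w = m ^ 2 := by
  induction T using WellFoundedLT.induction with
  | ind T ih =>
  intro hT k w hw hk
  by_cases hb : T = ⊥
  · subst hb
    have hq : quad (⊥ : SimpleGraph V) = {fun _ x => x} := by
      ext M
      simp only [mem_quad, IsTM, SimpleGraph.bot_adj, or_false, Finset.mem_singleton]
      constructor
      · intro h; funext i x; exact (h i x).2
      · rintro rfl; simp
    have hW : W (⊥ : SimpleGraph V) w = ∏ x, w x ∅ := by
      rw [W, hq, Finset.sum_singleton]
      refine Finset.prod_congr rfl fun x _ => ?_
      congr 1
      ext i; simp [mem_cov]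
    rw [hW]
    rcases good_prod k w hw Finset.univ with h | h
    · exact h.2
    · exact absurd hk (Nat.not_even_iff_odd.2 h.1)
  · obtain ⟨l, v, hlv, hu⟩ := exists_leaf T hT hb
    have hne : l ≠ v := hlv.ne
    rw [W_isol T l v hlv hu]
    have hle : isol T l ≤ T := fun x y h => h.1
    refine ih _ (lt_of_le_of_ne hle fun h => ?_) (hT.anti hle)
      (Function.update (Function.update k v (k v + k l)) l 0) _ ?_ ?_
    · rw [← h] at hlv
      exact hlv.2.1 rfl
    · intro x
      by_cases hxl : x = l
      · subst hxl
        simp only [Function.update_self]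
        exact Or.inl ⟨by simp, 1, 0, by simp⟩
      · rw [Function.update_of_ne hxl, Function.update_of_ne hxl]
        by_cases hxv : x = v
        · subst hxv
          simp only [Function.update_self]
          exact (hw x).absorb (hw l)
        · rw [Function.update_of_ne hxv, Function.update_of_ne hxv]
          exact hw x
    · convert hk using 1
      rw [← Finset.add_sum_erase _ _ (Finset.mem_univ l),
        ← Finset.add_sum_erase _ k (Finset.mem_univ l),
        ← Finset.add_sum_erase (Finset.univ.erase l) _ (show v ∈ _ by simp [hne.symm]),
        ← Finset.add_sum_erase (Finset.univ.erase l) k (show v ∈ _ by simp [hne.symm])]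
      have : ∑ x ∈ (Finset.univ.erase l).erase v,
          (Function.update (Function.update k v (k v + k l)) l 0) x =
          ∑ x ∈ (Finset.univ.erase l).erase v, k x := by
        refine Finset.sum_congr rfl fun x hx => ?_
        simp only [Finset.mem_erase, Finset.mem_univ, and_true] at hx
        rw [Function.update_of_ne hx.2, Function.update_of_ne hx.1]
      rw [this]
      simp only [Function.update_self, Function.update_of_ne hne.symm]
      ring

/-- Perfect matchings as involutions. -/
noncomputable def invs {X : Type*} [Fintype X] (G : SimpleGraph X) : Finset (X → X) :=
  Finset.univ.filter fun f => ∀ x, f (f x) = x ∧ G.Adj x (f x)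

lemma Pm_eq {X : Type*} [Fintype X] (G : SimpleGraph X) : Pm G = (invs G).card := by
  rw [Pm, ← Set.ncard_coe_finset]
  symm
  have hmem : ∀ f, f ∈ (invs G : Set (X → X)) ↔ ∀ x, f (f x) = x ∧ G.Adj x (f x) := by
    intro f; simp [invs]
  refine Set.ncard_congr (fun f hf =>
    { verts := Set.univ
      Adj := fun x y => f x = y
      adj_sub := by
        rintro x y rfl
        exact (((hmem f).1 hf) x).2
      edge_vert := fun _ => trivial
      symm := ⟨by
        rintro x y rfl
        exact (((hmem f).1 hf) x).1⟩ }) ?_ ?_ ?_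
  · intro f hf
    rw [Set.mem_ofPred_eq, SimpleGraph.Subgraph.isPerfectMatching_iff]
    intro x
    exact ⟨f x, rfl, fun y hy => Eq.symm hy⟩
  · intro f g hf hg h
    funext x
    have := congrArg (fun M : G.Subgraph => M.Adj x (g x)) h
    simpa using this
  · intro M hM
    rw [Set.mem_ofPred_eq, SimpleGraph.Subgraph.isPerfectMatching_iff] at hM
    choose f hf hf' using hM
    refine ⟨f, (hmem f).2 fun x => ⟨(hf' _ _ (hf x).symm).symm, (hf x).adj_sub⟩, ?_⟩
    ext x y
    · simpa using M.edge_vert (hf x)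
    · constructor
      · rintro rfl; exact hf x
      · intro h; exact (hf' x y h).symm

lemma card_invs {V : Type*} [Fintype V] (T : SimpleGraph V) :
    (invs (cycleGraph 4 □ T)).card = W T (fun _ => base 2 1 1) := by
  have h1 : W T (fun _ => base 2 1 1) =
      ((quad T).sigma fun M => Fintype.piFinset fun x => cyc (cov M x)).card := by
    rw [W, Finset.card_sigma]
    refine Finset.sum_congr rfl fun M _ => ?_
    rw [Fintype.card_piFinset]
    exact Finset.prod_congr rfl fun x _ => (card_cyc _).symm
  rw [h1]
  have hi : ∀ f, f ∈ invs (cycleGraph 4 □ T) ↔ ∀ i x, f (f (i, x)) = (i, x) ∧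
      ((((f (i, x)).1 = i + 1 ∨ i = (f (i, x)).1 + 1) ∧ (f (i, x)).2 = x) ∨
        (T.Adj x (f (i, x)).2 ∧ (f (i, x)).1 = i)) := by
    intro f
    simp only [invs, Finset.mem_filter, Finset.mem_univ, true_and, Prod.forall,
      SimpleGraph.boxProd_adj, c4_adj]
    grind
  have hs : ∀ p : (_ : Fin 4 → V → V) × (V → Fin 4 → Fin 4),
      p ∈ ((quad T).sigma fun M => Fintype.piFinset fun x => cyc (cov M x)) ↔
      (∀ i x, p.1 i (p.1 i x) = x ∧ (p.1 i x = x ∨ T.Adj x (p.1 i x))) ∧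
      ∀ x i, p.2 x (p.2 x i) = i ∧ if p.1 i x ≠ x then p.2 x i = i else
        (p.2 x i = i + 1 ∨ i = p.2 x i + 1) := by
    intro p
    simp only [Finset.mem_sigma, mem_quad, Fintype.mem_piFinset, cyc, mem_cov, IsTM,
      Finset.mem_filter, Finset.mem_univ, true_and]
  have n1 : ∀ i : Fin 4, i + 1 ≠ i := by decide
  refine Finset.card_bij' (fun f _ => ⟨fun i x => (f (i, x)).2, fun x i => (f (i, x)).1⟩)
    (fun p _ q => (p.2 q.2 q.1, p.1 q.1 q.2)) ?_ ?_ ?_ ?_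
  · intro f hf
    rw [hi] at hf
    rw [hs]
    have ht : ∀ x y, T.Adj x y → x ≠ y := fun x y h => h.ne
    constructor
    · intro i x
      obtain ⟨h1, h2⟩ := hf i x
      rcases h2 with ⟨h2, h3⟩ | ⟨h2, h3⟩
      · simp only [h3, true_or, and_self]
      · have e : f (i, x) = (i, (f (i, x)).2) := Prod.ext h3 rfl
        rw [e] at h1
        simp only [h1, h2, or_true, and_self]
    · intro x i
      obtain ⟨h1, h2⟩ := hf i x
      rcases h2 with ⟨h2, h3⟩ | ⟨h2, h3⟩
      · have e : f (i, x) = ((f (i, x)).1, x) := Prod.ext rfl h3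
        rw [e] at h1
        simp only [h1, h2, h3, ne_eq, not_true_eq_false, if_false, and_self]
      · have := (ht _ _ h2).symm
        simp only [h3, ne_eq, this, not_false_eq_true, if_true, and_self]
  · intro p hp
    rw [hs] at hp
    rw [hi]
    intro i x
    obtain ⟨hp1, hp2⟩ := hp
    have a1 := hp1 i x
    have a2 := hp2 x i
    by_cases hx : p.1 i x = x
    · rw [if_neg (not_not.2 hx)] at a2
      have b : p.1 (p.2 x i) x = x := by
        by_contra hc
        have a3 := (hp2 x (p.2 x i)).2
        rw [if_pos hc, a2.1] at a3
        rcases a2.2 with h | h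
        · exact n1 i (by rw [← h]; exact a3.symm)
        · exact n1 i (by rw [← a3] at h; exact h.symm)
      simp only [hx, b, a2.1, true_and]
      exact Or.inl ⟨a2.2, trivial⟩
    · rw [if_pos hx] at a2
      have hx' : p.1 i (p.1 i x) ≠ p.1 i x := by rw [a1.1]; exact fun h => hx h.symm
      have a3 := (hp2 (p.1 i x) i).2
      rw [if_pos hx'] at a3
      simp only [a2.2, a3, a1.1, true_and]
      exact Or.inr ⟨a1.2.resolve_left hx, trivial⟩
  · intro f hf
    rfl
  · intro p hp
    rfl

end

/-- For a tree `T` with a perfect matching, the number of perfect matchings of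
`C_4 × T` is a perfect square. -/
theorem pm_c4_boxProd_tree_square {V : Type*} [Fintype V]
    (T : SimpleGraph V) (hT : T.IsTree)
    (hM : ∃ M : T.Subgraph, M.IsPerfectMatching) :
    ∃ m : ℕ, Pm (cycleGraph 4 □ T) = m ^ 2 := by
  obtain ⟨M, hM⟩ := hM
  have he := hM.even_card
  rw [Pm_eq, card_invs]
  refine W_square T hT.isAcyclic (fun _ => 1) _ (fun _ => Or.inr ⟨odd_one, 1, 1, by simp⟩) ?_
  simpa using he
end

section
/- Let T be a tree that has a perfect matching. Then the number of perfect matchings of the Cartesian product P_3 × T equals the product of (2 + α²) taken over all positive eigenvalues α (with multiplicity) of the adjacency matrix of T, where P_3 is the path on 3 vertices. -/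
open SimpleGraph

/-- A matching of `T`, encoded as an involution moving vertices along edges. -/
def IsInv {V : Type*} (T : SimpleGraph V) (f : V → V) : Prop :=
  ∀ v, f (f v) = v ∧ (f v ≠ v → T.Adj v (f v))

lemma no_leaf {V : Type*} [Finite V] {T : SimpleGraph V} (hT : T.IsAcyclic)
    (R : V → V → Prop) (_hs : ∀ a b, R a b → R b a) (hR : ∀ a b, R a b → T.Adj a b)
    (hl : ∀ a b, R a b → ∃ c, c ≠ a ∧ R b c) : ∀ a b, ¬ R a b := by
  intro a b hab
  have : Fintype V := Fintype.ofFinite V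
  have key : ∀ n : ℕ, ∃ (u v : V) (p : T.Walk u v), p.IsPath ∧ p.length = n + 1 ∧
      R p.penultimate v := by
    intro n
    induction n with
    | zero =>
      refine ⟨a, b, Walk.cons (hR _ _ hab) Walk.nil, ?_, rfl, by simpa [Walk.penultimate] using hab⟩
      simp [(hR _ _ hab).ne]
    | succ n ih =>
      obtain ⟨u, v, p, hp, hlen, hpen⟩ := ih
      obtain ⟨c, hc, hvc⟩ := hl _ _ hpen
      have hcs : c ∉ p.support := fun h =>
        hc (hT.eq_penultimate_of_adj_end hp (hR _ _ hvc) h)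
      refine ⟨u, c, p.concat (hR _ _ hvc), hp.concat hcs _, by simp [hlen], ?_⟩
      simpa using hvc
  obtain ⟨u, v, p, hp, hlen, -⟩ := key (Fintype.card V)
  have := hp.length_lt
  omega

lemma perm_invol {V : Type*} [Finite V] {T : SimpleGraph V} (hT : T.IsAcyclic)
    (σ : Equiv.Perm V) (hσ : ∀ v, σ v ≠ v → T.Adj v (σ v)) : ∀ v, σ (σ v) = v := by
  have := no_leaf hT (fun a b => (b = σ a ∧ σ (σ a) ≠ a) ∨ (a = σ b ∧ σ (σ b) ≠ b))
    (fun a b h => h.symm) ?_ ?_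
  · intro v
    by_contra h
    exact this v (σ v) (Or.inl ⟨rfl, h⟩)
  · rintro a b (⟨rfl, h⟩ | ⟨rfl, h⟩)
    · exact hσ _ (fun h' => h (by rw [h', h']))
    · exact (hσ _ (fun h' => h (by rw [h', h']))).symm
  · rintro a b (⟨rfl, h⟩ | ⟨rfl, h⟩)
    · exact ⟨σ (σ a), h, Or.inl ⟨rfl, fun h' => h (σ.injective h')⟩⟩
    · refine ⟨σ.symm b, fun h' => h ?_, Or.inr ⟨by simp, fun h' => h ?_⟩⟩
      · rw [← h']; simp
      · have := congrArg σ h'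
        simp at this
        exact this

/-- number of occurrences of `c` among the four values -/
def cnt {V : Type*} [DecidableEq V] (p q r s c : V) : ℕ :=
  (if p = c then 1 else 0) + (if q = c then 1 else 0) + (if r = c then 1 else 0) +
    (if s = c then 1 else 0)

lemma cnt_other {V : Type*} [DecidableEq V] {p q r s a b : V} (hab : a ≠ b) (hq : q ≠ b)
    (h : p = b ↔ (r = b ∨ s = b)) (h2 : ¬ (r = b ∧ s = b)) (ho : cnt p q r s a % 2 = 1) :
    ∃ c, c ≠ a ∧ c ≠ b ∧ cnt p q r s c % 2 = 1 := by
  by_contra hcon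
  push Not at hcon
  have h1 := hcon p
  have h3 := hcon q
  have h4 := hcon r
  have h5 := hcon s
  unfold cnt at *
  grind

lemma trichotomy {V : Type*} [Finite V] {T : SimpleGraph V} (hT : T.IsAcyclic)
    {M N P Q : V → V} (hM : IsInv T M) (hN : IsInv T N) (hP : IsInv T P) (hQ : IsInv T Q)
    (hN0 : ∀ v, N v ≠ v) (h : ∀ v, M v = v ↔ (P v = v ∨ Q v = v))
    (h2 : ∀ v, ¬ (P v = v ∧ Q v = v)) (v : V) :
    (M v = N v ∧ P v = Q v ∧ M v ≠ v ∧ P v ≠ v) ∨ (P v = M v ∧ Q v = N v) ∨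
      (P v = N v ∧ Q v = M v) := by
  classical
  have hsym : ∀ f : V → V, IsInv T f → ∀ a b, f a = b ↔ f b = a := fun f hf a b =>
    ⟨fun e => e ▸ (hf a).1, fun e => e ▸ (hf b).1⟩
  have key := no_leaf hT
    (fun a b => a ≠ b ∧ cnt (M a) (N a) (P a) (Q a) b % 2 = 1) ?_ ?_ ?_
  · have k1 := key v (M v)
    have k2 := key v (N v)
    have k3 := key v (P v)
    have k4 := key v (Q v)
    have := hN0 v
    have := h v
    have := h2 v
    unfold cnt at *
    grind
  · rintro a b ⟨hab, ho⟩
    refine ⟨hab.symm, ?_⟩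
    unfold cnt at *
    simp only [hsym M hM b a, hsym N hN b a, hsym P hP b a, hsym Q hQ b a]
    exact ho
  · rintro a b ⟨hab, ho⟩
    have := (hM a).2
    have := (hN a).2
    have := (hP a).2
    have := (hQ a).2
    unfold cnt at *
    grind
  · rintro a b ⟨hab, ho⟩
    have ho' : cnt (M b) (N b) (P b) (Q b) a % 2 = 1 := by
      unfold cnt at *
      simp only [hsym M hM b a, hsym N hN b a, hsym P hP b a, hsym Q hQ b a]
      exact ho
    obtain ⟨c, hc, hcb, hcc⟩ := cnt_other hab (hN0 b) (h b) (h2 b) ho'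
    exact ⟨c, hc, hcb.symm, hcc⟩

lemma dichotomy {V : Type*} [Finite V] {T : SimpleGraph V} (hT : T.IsAcyclic)
    {M N P Q : V → V} (hM : IsInv T M) (hN : IsInv T N) (hP : IsInv T P) (hQ : IsInv T Q)
    (hN0 : ∀ v, N v ≠ v) (h : ∀ v, M v = v ↔ (P v = v ∨ Q v = v))
    (h2 : ∀ v, ¬ (P v = v ∧ Q v = v)) (v : V) :
    (P v = M v ∧ Q v = N v) ∨ (P v = N v ∧ Q v = M v) := by
  have tri := trichotomy hT hM hN hP hQ hN0 h h2
  let S : V → Prop := fun v => M v = N v ∧ P v = Q v ∧ M v ≠ v ∧ P v ≠ v ∧ P v ≠ M v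
  have hSM : ∀ v, S v → S (M v) := by
    intro v hv
    have := tri (M v)
    have := hM v
    have := hN v
    have := hP v
    have := hP (M v)
    have := hQ v
    have := hQ (M v)
    have := h (M v)
    grind
  have hSP : ∀ v, S v → S (P v) := by
    intro v hv
    have := tri (P v)
    have := hM v
    have := hM (P v)
    have := hN (P v)
    have := hN v
    have := hP v
    have := hQ v
    have := h (P v)
    grind
  have key := no_leaf hT (fun a b => S a ∧ (b = M a ∨ b = P a)) ?_ ?_ ?_
  · rcases tri v with h' | h'
    · have := key v (M v)
      grind
    · exact h'
  · rintro a b ⟨hS, rfl | rfl⟩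
    · exact ⟨hSM _ hS, Or.inl (hM a).1.symm⟩
    · exact ⟨hSP _ hS, Or.inr (hP a).1.symm⟩
  · rintro a b ⟨hS, rfl | rfl⟩
    · exact (hM a).2 hS.2.2.1
    · exact (hP a).2 hS.2.2.2.1
  · rintro a b ⟨hS, rfl | rfl⟩
    · refine ⟨P (M a), ?_, hSM _ hS, Or.inr rfl⟩
      have := (hSM _ hS).2.2.2.2
      rwa [(hM a).1] at this
    · refine ⟨M (P a), ?_, hSP _ hS, Or.inl rfl⟩
      have := (hSP _ hS).2.2.2.2
      rw [(hP a).1] at this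
      exact this.symm

lemma comp_count {W : Type*} [Fintype W] {G : SimpleGraph W} [DecidableRel G.Adj]
    [Fintype G.ConnectedComponent] (hG : G.IsAcyclic) :
    ∑ v, (2 - (G.degree v : ℤ)) = 2 * (Fintype.card G.ConnectedComponent : ℤ) := by
  classical
  have h1 : ∀ c : G.ConnectedComponent,
      ∑ v ∈ Finset.univ.filter (fun v => G.connectedComponentMk v = c),
        (2 - (G.degree v : ℤ)) = 2 := by
    intro c
    have ht := hG.isTree_connectedComponent c
    have hE := ht.card_edgeFinset
    have hS := c.toSimpleGraph.sum_degrees_eq_twice_card_edges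
    have hd : ∀ v : c, c.toSimpleGraph.degree v = G.degree v.1 := by
      intro v
      rw [← SimpleGraph.card_neighborFinset_eq_degree, ← SimpleGraph.card_neighborFinset_eq_degree]
      refine Finset.card_bij (fun w _ => w.1) ?_ ?_ ?_
      · intro w hw
        rw [mem_neighborFinset] at hw ⊢
        exact hw
      · intro a _ b _ h
        exact Subtype.ext h
      · intro w hw
        have hw' : G.Adj v.1 w := by simpa using hw
        refine ⟨⟨w, ?_⟩, ?_, rfl⟩
        · exact ConnectedComponent.mem_supp_of_adj_mem_supp _ v.2 hw'
        · rw [mem_neighborFinset]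
          exact hw'
    have e : ∑ v ∈ Finset.univ.filter (fun v => G.connectedComponentMk v = c),
        (2 - (G.degree v : ℤ)) = ∑ v : c, (2 - (c.toSimpleGraph.degree v : ℤ)) := by
      simp only [hd]
      refine Finset.sum_subtype (p := fun v => v ∈ c) _ ?_ _
      intro v
      simp
      rfl
    rw [e, Finset.sum_sub_distrib]
    have hS' : ∑ v : c, (c.toSimpleGraph.degree v : ℤ) = 2 * c.toSimpleGraph.edgeFinset.card := by
      exact_mod_cast hS
    rw [hS']
    simp only [Finset.sum_const, Finset.card_univ, nsmul_eq_mul]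
    have : (c.toSimpleGraph.edgeFinset.card : ℤ) + 1 = Fintype.card c := by exact_mod_cast hE
    rw [← this]; ring
  rw [← Finset.sum_fiberwise (s := Finset.univ) (g := fun v => G.connectedComponentMk v)]
  simp only [h1]
  simp [mul_comm]

/-- `(P, Q)` completes `M` to a perfect matching of `P₃ □ T`. -/
def GoodPair {V : Type*} (T : SimpleGraph V) (M : V → V) (x : (V → V) × (V → V)) : Prop :=
  IsInv T x.1 ∧ IsInv T x.2 ∧ (∀ v, M v = v ↔ (x.1 v = v ∨ x.2 v = v)) ∧
    ∀ v, ¬ (x.1 v = v ∧ x.2 v = v)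

/-- The symmetric difference of two matchings. -/
def symGraph {V : Type*} {T : SimpleGraph V} {M N : V → V} (hM : IsInv T M) (hN : IsInv T N) :
    SimpleGraph {v // M v ≠ N v} where
  Adj a b := a ≠ b ∧ (M a = b.1 ∨ N a = b.1)
  symm := ⟨by
    rintro a b ⟨h, h' | h'⟩
    · exact ⟨h.symm, Or.inl (h' ▸ (hM a).1)⟩
    · exact ⟨h.symm, Or.inr (h' ▸ (hN a).1)⟩⟩
  loopless := ⟨fun a h => h.1 rfl⟩

lemma symGraph_acyclic {V : Type*} {T : SimpleGraph V} (hT : T.IsAcyclic) {M N : V → V}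
    (hM : IsInv T M) (hN : IsInv T N) : (symGraph hM hN).IsAcyclic := by
  refine hT.comap (f := ⟨Subtype.val, ?_⟩) Subtype.val_injective
  rintro a b ⟨h, h' | h'⟩
  · have := (hM a).2 (fun e => h (Subtype.ext (e.symm.trans h')))
    rwa [h'] at this
  · have := (hN a).2 (fun e => h (Subtype.ext (e.symm.trans h')))
    rwa [h'] at this

lemma symGraph_stable {V : Type*} {T : SimpleGraph V} {M N : V → V}
    (hM : IsInv T M) (hN : IsInv T N) (v : V) :
    (M (M v) = N (M v) ↔ M v = N v) ∧ (M (N v) = N (N v) ↔ M v = N v) := by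
  have := hM v
  have := hN v
  have := hM (N v)
  have := hN (M v)
  grind

lemma symGraph_card {V : Type*} [Fintype V] [DecidableEq V] {T : SimpleGraph V}
    (hT : T.IsAcyclic) {M N : V → V}
    (hM : IsInv T M) (hN : IsInv T N) (hN0 : ∀ v, N v ≠ v) :
    2 * Nat.card (symGraph hM hN).ConnectedComponent =
      (Finset.univ.filter (fun v => M v = v)).card := by
  classical
  have : Fintype (symGraph hM hN).ConnectedComponent := Fintype.ofFinite _
  have h := comp_count (symGraph_acyclic hT hM hN)
  have hd : ∀ v : {v // M v ≠ N v}, (2 - ((symGraph hM hN).degree v : ℤ)) =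
      if M v = v.1 then 1 else 0 := by
    intro v
    have hst := symGraph_stable hM hN v
    have hc : (symGraph hM hN).degree v = (({M v.1, N v.1} : Finset V).erase v.1).card := by
      rw [← SimpleGraph.card_neighborFinset_eq_degree]
      refine Finset.card_bij (fun w _ => w.1) ?_ ?_ ?_
      · intro w hw
        have hw' : (symGraph hM hN).Adj v w := by simpa using hw
        obtain ⟨h1, h2⟩ := hw'
        have : w.1 ≠ v.1 := fun e => h1 (Subtype.ext e.symm)
        simp [this]
        rcases h2 with h2 | h2 <;> simp [h2]
      · intro a _ b _ h
        exact Subtype.ext h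
      · intro w hw
        simp only [Finset.mem_erase, Finset.mem_insert, Finset.mem_singleton] at hw
        have hw2 : M w ≠ N w := by
          have := v.2
          rcases hw.2 with rfl | rfl
          · exact fun e => this (hst.1.1 e)
          · exact fun e => this (hst.2.1 e)
        refine ⟨⟨w, hw2⟩, ?_, rfl⟩
        simp only [mem_neighborFinset]
        refine ⟨fun e => hw.1 (by rw [e]), ?_⟩
        rcases hw.2 with e | e
        · exact Or.inl e.symm
        · exact Or.inr e.symm
    rw [hc]
    by_cases hv : M v = v.1
    · simp [hv, Finset.erase_insert_eq_erase, Finset.erase_eq_of_notMem, (hN0 v.1).symm]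
    · rw [Finset.erase_eq_of_notMem (by simp [Ne.symm hv, (hN0 v.1).symm]),
        Finset.card_pair v.2]
      simp [hv]
  simp only [hd] at h
  rw [Finset.sum_boole] at h
  have h3 : (Finset.univ.filter (fun v => M v = v)).card =
      (Finset.univ.filter (fun v : {v // M v ≠ N v} => M v = v.1)).card := by
    symm
    refine Finset.card_bij (fun w _ => w.1) ?_ ?_ ?_
    · intro w hw; simpa using hw
    · intro a _ b _ h
      exact Subtype.ext h
    · intro w hw
      have hw' : M w = w := by simpa using hw
      exact ⟨⟨w, by rw [hw']; exact (hN0 w).symm⟩, by simpa using hw', rfl⟩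
  rw [h3, Nat.card_eq_fintype_card]
  exact_mod_cast h.symm

lemma card_goodPair {V : Type*} [Fintype V] [DecidableEq V] {T : SimpleGraph V}
    (hT : T.IsAcyclic) {M N : V → V}
    (hM : IsInv T M) (hN : IsInv T N) (hN0 : ∀ v, N v ≠ v) :
    Nat.card {x : (V → V) × (V → V) // GoodPair T M x} =
      2 ^ ((Finset.univ.filter (fun v => M v = v)).card / 2) := by
  classical
  rw [← symGraph_card hT hM hN hN0]
  rw [Nat.mul_div_cancel_left _ (by norm_num)]
  have h2 : Nat.card ((symGraph hM hN).ConnectedComponent → Bool) =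
      2 ^ Nat.card (symGraph hM hN).ConnectedComponent := by
    rw [Nat.card_fun]; simp
  rw [← h2]
  symm
  let col : ((symGraph hM hN).ConnectedComponent → Bool) → V → Bool := fun c v =>
    if h : M v ≠ N v then c ((symGraph hM hN).connectedComponentMk ⟨v, h⟩) else true
  have hcolM : ∀ c v, col c (M v) = col c v := by
    intro c v
    have hst := (symGraph_stable hM hN v).1
    by_cases h : M v = N v
    · have h' := hst.2 h
      simp only [col]
      rw [dif_neg (by simpa using h'), dif_neg (by simpa using h)]
    · have h' : ¬ _ := fun e => h (hst.1 e)
      simp only [col]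
      rw [dif_pos h', dif_pos h]
      by_cases e : M v = v
      · congr 2; exact Subtype.ext e
      congr 1
      apply ConnectedComponent.sound
      refine SimpleGraph.Adj.reachable ⟨fun e' => e (congrArg Subtype.val e'), Or.inl (hM v).1⟩
  have hcolN : ∀ c v, col c (N v) = col c v := by
    intro c v
    have hst := (symGraph_stable hM hN v).2
    by_cases h : M v = N v
    · have h' := hst.2 h
      simp only [col]
      rw [dif_neg (by simpa using h'), dif_neg (by simpa using h)]
    · have h' : ¬ _ := fun e => h (hst.1 e)
      simp only [col]
      rw [dif_pos h', dif_pos h]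
      by_cases e : N v = v
      · congr 2; exact Subtype.ext e
      congr 1
      apply ConnectedComponent.sound
      refine SimpleGraph.Adj.reachable ⟨fun e' => e (congrArg Subtype.val e'), Or.inr (hN v).1⟩
  let P : ((symGraph hM hN).ConnectedComponent → Bool) → V → V := fun c v =>
    if col c v then M v else N v
  let Q : ((symGraph hM hN).ConnectedComponent → Bool) → V → V := fun c v =>
    if col c v then N v else M v
  have hP : ∀ c, IsInv T (P c) := by
    intro c v
    have := hM v
    have := hN v
    have := hcolM c v
    have := hcolN c v
    simp only [P]
    grind
  have hQ : ∀ c, IsInv T (Q c) := by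
    intro c v
    have := hM v
    have := hN v
    have := hcolM c v
    have := hcolN c v
    simp only [Q]
    grind
  refine Nat.card_congr (Equiv.ofBijective (fun c => ⟨(P c, Q c), hP c, hQ c, ?_, ?_⟩) ⟨?_, ?_⟩)
  · intro v
    have := hN0 v
    have hcM := hM v
    simp only [P, Q]
    grind
  · intro v
    have := hN0 v
    simp only [P, Q]
    grind
  · intro c c' hcc
    have hPP : P c = P c' := congrArg (fun x => x.1.1) hcc
    funext k
    induction k using ConnectedComponent.ind with
    | h w =>
    have h := congrFun hPP w.1
    have e1 : ∀ c, col c w.1 = c ((symGraph hM hN).connectedComponentMk w) := by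
      intro c
      simp only [col]
      rw [dif_pos w.2]
    have hw := w.2
    simp only [P, e1] at h
    grind
  · rintro ⟨⟨p, q⟩, hp, hq, h, h2⟩
    have dich := dichotomy hT hM hN hp hq hN0 h h2
    simp only at hp hq
    let c : (symGraph hM hN).ConnectedComponent → Bool :=
      ConnectedComponent.lift (fun w => decide (p w.1 = M w.1)) (by
        intro v w pw _
        induction pw with
        | nil => rfl
        | @cons a b _ hadj _ ih =>
          rw [← ih (by simp_all)]
          have := dich a
          have := dich b
          have := hp a
          have := hp b
          have := hq a
          have := hq b
          have := hM a
          have := hM b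
          have := hN a
          have := hN b
          have := a.2
          have := b.2
          obtain ⟨-, h'⟩ := hadj
          grind)
    have hc : ∀ v, M v ≠ N v → (col c v = true ↔ p v = M v) := by
      intro v hv
      simp only [col]
      rw [dif_pos hv]
      simp [c]
    refine ⟨c, Subtype.ext (Prod.ext ?_ ?_)⟩
    · funext v
      have := dich v
      have := hc v
      simp only [P]
      grind
    · funext v
      have := dich v
      have := hc v
      simp only [Q]
      grind

lemma Pm_eq_s5 {V : Type*} (G : SimpleGraph V) :
    Pm G = Nat.card {f : V → V // ∀ v, f (f v) = v ∧ G.Adj v (f v)} := by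
  unfold Pm
  rw [← Nat.card_coe_set_eq]
  symm
  refine Nat.card_congr (Equiv.ofBijective (fun f => ⟨
    { verts := Set.univ
      Adj := fun a b => f.1 a = b
      adj_sub := fun {a b} h => by rw [← h]; exact (f.2 a).2
      edge_vert := fun _ => trivial
      symm := ⟨fun a b h => by rw [← h]; exact (f.2 a).1⟩ }, ?_⟩) ⟨?_, ?_⟩)
  · change Subgraph.IsPerfectMatching _
    rw [Subgraph.isPerfectMatching_iff]
    intro v
    exact ⟨f.1 v, rfl, fun y hy => Eq.symm hy⟩
  · intro f g h
    apply Subtype.ext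
    funext v
    have h' : (f.1 v = g.1 v) = (g.1 v = g.1 v) := congrArg (fun x => x.1.Adj v (g.1 v)) h
    exact h'.mpr rfl
  · rintro ⟨M, hM⟩
    have hM' := (Subgraph.isPerfectMatching_iff).1 hM
    choose f hf using hM'
    refine ⟨⟨f, fun v => ⟨?_, M.adj_sub (hf v).1⟩⟩, ?_⟩
    · exact ((hf (f v)).2 v (hf v).1.symm).symm
    · apply Subtype.ext
      apply Subgraph.ext
      · exact (Subgraph.isSpanning_iff.1 hM.2).symm
      · funext a b
        apply propext
        constructor
        · rintro rfl; exact (hf a).1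
        · intro h; exact ((hf a).2 b h).symm

lemma adj3 {V : Type*} (T : SimpleGraph V) (i j : Fin 3) (a b : V) :
    (pathGraph 3 □ T).Adj (i, a) (j, b) ↔
      (((i = 1 ∧ j ≠ 1) ∨ (i ≠ 1 ∧ j = 1)) ∧ a = b) ∨ (T.Adj a b ∧ i = j) := by
  rw [boxProd_adj, pathGraph_adj]
  fin_cases i <;> fin_cases j <;> simp

/-- Assemble a perfect matching of `P₃ □ T`. -/
noncomputable def asm {V : Type*} [DecidableEq V] (M P Q : V → V) : Fin 3 × V → Fin 3 × V :=
  fun x => if x.1 = 0 then (if P x.2 = x.2 then (1, x.2) else (0, P x.2))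
    else if x.1 = 2 then (if Q x.2 = x.2 then (1, x.2) else (2, Q x.2))
    else if M x.2 = x.2 then (if P x.2 = x.2 then (0, x.2) else (2, x.2)) else (1, M x.2)

lemma asm0 {V : Type*} [DecidableEq V] (M P Q : V → V) (v : V) :
    asm M P Q (0, v) = if P v = v then (1, v) else (0, P v) := rfl

lemma asm1 {V : Type*} [DecidableEq V] (M P Q : V → V) (v : V) :
    asm M P Q (1, v) = if M v = v then (if P v = v then (0, v) else (2, v)) else (1, M v) := rfl

lemma asm2 {V : Type*} [DecidableEq V] (M P Q : V → V) (v : V) :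
    asm M P Q (2, v) = if Q v = v then (1, v) else (2, Q v) := rfl

lemma asm_spec {V : Type*} [DecidableEq V] {T : SimpleGraph V} {M P Q : V → V}
    (hM : IsInv T M) (hx : GoodPair T M (P, Q)) (x : Fin 3 × V) :
    asm M P Q (asm M P Q x) = x ∧ (pathGraph 3 □ T).Adj x (asm M P Q x) := by
  obtain ⟨hP, hQ, h, h2⟩ := hx
  obtain ⟨i, v⟩ := x
  have k1 := hM v
  have k2 := hP v
  have k3 := hQ v
  have k4 := h v
  have k5 := h2 v
  clear hM hP hQ h h2
  simp only at k1 k2 k3 k4 k5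
  have hi : i = 0 ∨ i = 1 ∨ i = 2 := by fin_cases i <;> simp
  rcases hi with rfl | rfl | rfl
  · by_cases c : P v = v
    · have c1 : M v = v := k4.2 (Or.inl c)
      simp [asm0, asm1, c, c1, pathGraph_adj]
    · have : P v ≠ v := c
      simp [asm0, c, Ne.symm c, k2.1, k2.2 c, pathGraph_adj]
  · by_cases c : M v = v
    · by_cases d : P v = v
      · simp [asm0, asm1, c, d, pathGraph_adj]
      · have e : Q v = v := (k4.1 c).resolve_left d
        simp [asm1, asm2, c, d, e, pathGraph_adj]
    · simp [asm1, c, Ne.symm c, k1.1, k1.2 c, pathGraph_adj]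
  · by_cases c : Q v = v
    · have c1 : M v = v := k4.2 (Or.inr c)
      have c2 : P v ≠ v := fun e => k5 ⟨e, c⟩
      simp [asm2, asm1, c, c1, c2, pathGraph_adj]
    · simp [asm2, c, Ne.symm c, k3.1, k3.2 c, pathGraph_adj]

lemma Pm_prod {V : Type*} [Fintype V] [DecidableEq V] (T : SimpleGraph V) :
    Nat.card {f : Fin 3 × V → Fin 3 × V // ∀ v, f (f v) = v ∧ (pathGraph 3 □ T).Adj v (f v)} =
      Nat.card (Σ M : {M : V → V // IsInv T M},
        {x : (V → V) × (V → V) // GoodPair T M.1 x}) := by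
  classical
  symm
  refine Nat.card_congr (Equiv.ofBijective (fun z => ⟨asm z.1.1 z.2.1.1 z.2.1.2, ?_⟩) ⟨?_, ?_⟩)
  · exact asm_spec z.1.2 z.2.2
  · rintro ⟨⟨M, hM⟩, ⟨⟨P, Q⟩, hP, hQ, h, h2⟩⟩ ⟨⟨M', hM'⟩, ⟨⟨P', Q'⟩, hP', hQ', h', h2'⟩⟩ hz
    have hz' : asm M P Q = asm M' P' Q' := congrArg Subtype.val hz
    have e0 : ∀ (M P Q : V → V) v, (asm M P Q (0, v)).2 = P v := by
      intro M P Q v; rw [asm0]; split_ifs <;> simp only [*]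
    have e1 : ∀ (M P Q : V → V) v, (asm M P Q (1, v)).2 = M v := by
      intro M P Q v; rw [asm1]; split_ifs <;> simp only [*]
    have e2 : ∀ (M P Q : V → V) v, (asm M P Q (2, v)).2 = Q v := by
      intro M P Q v; rw [asm2]; split_ifs <;> simp only [*]
    have hM : M = M' := by funext v; rw [← e1 M P Q, hz', e1]
    have hP : P = P' := by funext v; rw [← e0 M P Q, hz', e0]
    have hQ : Q = Q' := by funext v; rw [← e2 M P Q, hz', e2]
    subst hM hP hQ
    rfl
  · rintro ⟨f, hf⟩
    have hstep : ∀ i v, ((f (i, v)).1 = i ∧ T.Adj v (f (i, v)).2) ∨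
        (((i = 1 ∧ (f (i, v)).1 ≠ 1) ∨ (i ≠ 1 ∧ (f (i, v)).1 = 1)) ∧ (f (i, v)).2 = v) := by
      intro i v
      have := (hf (i, v)).2
      rw [show f (i, v) = ((f (i, v)).1, (f (i, v)).2) from rfl, adj3] at this
      grind
    have hfix : ∀ i v, (f (i, v)).2 = v → (f (i, v)).1 ≠ i := by
      intro i v h1 h2
      have := (hf (i, v)).2
      rw [show f (i, v) = (i, v) from Prod.ext h2 h1] at this
      exact this.ne rfl
    have hinv : ∀ i, IsInv T (fun v => (f (i, v)).2) := by
      intro i v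
      rcases hstep i v with ⟨h1, h2⟩ | ⟨h1, h2⟩
      · refine ⟨?_, fun _ => h2⟩
        have := (hf (i, v)).1
        rw [show f (i, v) = (i, (f (i, v)).2) from Prod.ext h1 rfl] at this
        simp [this]
      · simp [h2]
    have hback : ∀ i j v, f (i, v) = (j, v) → f (j, v) = (i, v) := by
      intro i j v h
      have := (hf (i, v)).1
      rwa [h] at this
    have f0 : ∀ v, (f (0, v)).2 = v ↔ f (0, v) = (1, v) := by
      intro v
      have := hstep 0 v
      have := hfix 0 v
      grind
    have f2 : ∀ v, (f (2, v)).2 = v ↔ f (2, v) = (1, v) := by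
      intro v
      have := hstep 2 v
      have := hfix 2 v
      grind
    have f1 : ∀ v, (f (1, v)).2 = v ↔ (f (1, v) = (0, v) ∨ f (1, v) = (2, v)) := by
      intro v
      have h1 := hstep 1 v
      have h2 := hfix 1 v
      constructor
      · intro h
        have h3 := h2 h
        rw [show f (1, v) = ((f (1, v)).1, v) from Prod.ext rfl h]
        generalize (f (1, v)).1 = k at *
        fin_cases k <;> simp_all
      · rintro (h | h) <;> rw [h]
    have g0 : ∀ v, f (0, v) = (1, v) ↔ f (1, v) = (0, v) := fun v => ⟨hback _ _ _, hback _ _ _⟩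
    have g2 : ∀ v, f (2, v) = (1, v) ↔ f (1, v) = (2, v) := fun v => ⟨hback _ _ _, hback _ _ _⟩
    have hne : ∀ i v, (f (i, v)).2 ≠ v → f (i, v) = (i, (f (i, v)).2) := by
      intro i v h
      have := hstep i v
      grind
    refine ⟨⟨⟨fun v => (f (1, v)).2, hinv 1⟩, ⟨(fun v => (f (0, v)).2, fun v => (f (2, v)).2),
      hinv 0, hinv 2, ?_, ?_⟩⟩, ?_⟩
    · intro v
      simp only
      rw [f0, f1, f2, g0, g2]
    · intro v
      simp only
      rw [f0, f2, g0, g2]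
      rintro ⟨h1, h2⟩
      rw [h1] at h2
      simp at h2
    · apply Subtype.ext
      funext ⟨i, v⟩
      have a0 := hne 0 v
      have a1 := hne 1 v
      have a2 := hne 2 v
      have := f0 v
      have := f1 v
      have := f2 v
      have := g0 v
      have := g2 v
      have hi : i = 0 ∨ i = 1 ∨ i = 2 := by fin_cases i <;> simp
      simp only
      rcases hi with rfl | rfl | rfl
      · rw [asm0]; split_ifs <;> grind
      · rw [asm1]; split_ifs <;> grind
      · rw [asm2]; split_ifs <;> grind

lemma Pm_sum {V : Type*} [Fintype V] [DecidableEq V] {T : SimpleGraph V}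
    [DecidablePred (IsInv T)]
    (hT : T.IsAcyclic) {N : V → V} (hN : IsInv T N) (hN0 : ∀ v, N v ≠ v) :
    Pm (pathGraph 3 □ T) = ∑ M ∈ Finset.univ.filter (IsInv T),
      2 ^ ((Finset.univ.filter (fun v => M v = v)).card / 2) := by
  classical
  rw [Pm_eq_s5, Pm_prod, Nat.card_sigma]
  simp only [fun M : {M : V → V // IsInv T M} => card_goodPair hT M.2 hN hN0]
  symm
  exact Finset.sum_subtype (p := IsInv T) _ (by simp)
    (fun M => 2 ^ ((Finset.univ.filter (fun v => M v = v)).card / 2))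

open Polynomial in
lemma charpoly_expand {V : Type*} [Fintype V] [DecidableEq V] {T : SimpleGraph V}
    [DecidableRel T.Adj] [DecidablePred (IsInv T)] (hT : T.IsAcyclic)
    (he : ∀ M, IsInv T M → Even (Fintype.card V - (Finset.univ.filter (fun v => M v = v)).card)) :
    (T.adjMatrix ℝ).charpoly = ∑ M ∈ Finset.univ.filter (IsInv T),
      (-1) ^ ((Fintype.card V - (Finset.univ.filter (fun v => M v = v)).card) / 2) *
        X ^ (Finset.univ.filter (fun v => M v = v)).card := by
  rw [Matrix.charpoly, Matrix.det_apply]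
  symm
  rw [← Finset.sum_filter_add_sum_filter_not (s := (Finset.univ : Finset (Equiv.Perm V)))
    (p := fun σ => IsInv T σ)]
  rw [Finset.sum_eq_zero (s := Finset.univ.filter (fun σ : Equiv.Perm V => ¬ IsInv T σ)), add_zero]
  · refine Finset.sum_bij' (fun M hM => (Function.Involutive.toPerm M
      (fun v => ((Finset.mem_filter.1 hM).2 v).1))) (fun σ _ => ⇑σ) ?_ ?_ ?_ ?_ ?_
    · intro M hM
      exact Finset.mem_filter.2 ⟨Finset.mem_univ _, (Finset.mem_filter.1 hM).2⟩
    · intro σ hσ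
      simpa using hσ
    · intro M hM; rfl
    · intro σ hσ; ext; rfl
    · intro M hM
      have hM' := (Finset.mem_filter.1 hM).2
      set σ := Function.Involutive.toPerm M (fun v => (hM' v).1) with hσ
      have hσM : ∀ v, σ v = M v := fun v => rfl
      have h2 : σ ^ 2 = 1 := by
        ext v; simp [pow_two, hσM, (hM' v).1]
      rw [Equiv.Perm.sign_of_pow_two_eq_one h2]
      have hc : Fintype.card (Function.fixedPoints σ) =
          (Finset.univ.filter (fun v => M v = v)).card := by
        rw [Fintype.card_subtype]
        rfl
      rw [hc]
      have hp : ∏ i, (T.adjMatrix ℝ).charmatrix (σ i) i =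
          ∏ i, (if M i = i then (X : ℝ[X]) else -1) := by
        refine Finset.prod_congr rfl (fun i _ => ?_)
        rw [hσM]
        split_ifs with h
        · rw [h, Matrix.charmatrix_apply_eq]; simp
        · rw [Matrix.charmatrix_apply_ne _ _ _ h]
          simp [((hM' i).2 h).symm]
      rw [hp, Finset.prod_ite, Finset.prod_const, Finset.prod_const]
      have h3 : (Finset.univ.filter (fun v => ¬ M v = v)).card =
          Fintype.card V - (Finset.univ.filter (fun v => M v = v)).card := by
        rw [← Finset.card_compl, Finset.compl_filter]
      rw [h3, (he M hM').neg_one_pow, mul_one]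
      simp [Units.smul_def]
  · intro σ hσ
    have hσ' : ¬ IsInv T σ := by simpa using hσ
    have : ∃ i, σ i ≠ i ∧ ¬ T.Adj i (σ i) := by
      by_contra hcon
      push Not at hcon
      exact hσ' (fun v => ⟨perm_invol hT σ hcon v, hcon v⟩)
    obtain ⟨i, h1, h2⟩ := this
    rw [Finset.prod_eq_zero (Finset.mem_univ i), smul_zero]
    rw [Matrix.charmatrix_apply_ne _ _ _ h1]
    simpa using fun h : T.Adj (σ i) i => h2 h.symm

lemma prod_pos_roots (s : Multiset ℝ) (hneg : s.map (fun x => -x) = s) (h0 : (0 : ℝ) ∉ s)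
    (c : ℂ) (hc : c ^ 2 = -2) :
    (s.map (fun α : ℝ => c - (α : ℂ))).prod =
      (-1) ^ (s.card / 2) * (((s.filter (fun α => 0 < α)).map (fun α => 2 + α ^ 2)).prod : ℝ) := by
  have h1 : s.filter (fun α => ¬ 0 < α) = (s.filter (fun α => 0 < α)).map (fun x => -x) := by
    conv_lhs => rw [← hneg]
    rw [Multiset.filter_map]
    congr 1
    refine Multiset.filter_congr (fun x hx => ?_)
    have : x ≠ 0 := fun e => h0 (e ▸ hx)
    simp only [Function.comp, not_lt, Left.neg_nonpos_iff]
    exact ⟨fun h => lt_of_le_of_ne h this.symm, le_of_lt⟩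
  have h2 := Multiset.filter_add_not (fun α : ℝ => 0 < α) s
  rw [h1] at h2
  set t := s.filter (fun α => 0 < α) with ht
  clear_value t
  rw [← h2]
  have h3 : (t + t.map (fun x => -x)).card / 2 = t.card := by simp; omega
  rw [h3]
  clear h1 h2 h3 ht
  induction t using Multiset.induction_on with
  | empty => simp
  | cons a t ih =>
    simp only [Multiset.map_cons, Multiset.map_add, Multiset.prod_add, Multiset.prod_cons,
      Multiset.card_cons, Multiset.map_map] at ih ⊢
    have e : (c - (a : ℂ)) * (c - ((-a : ℝ) : ℂ)) = - (2 + (a : ℂ) ^ 2) := by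
      push_cast
      linear_combination hc
    push_cast at ih e ⊢
    rw [pow_succ]
    linear_combination (-(2 + (a : ℂ) ^ 2)) * ih + (Multiset.map (fun α : ℝ => c - (α : ℂ)) t).prod *
      (Multiset.map ((fun α : ℝ => c - (α : ℂ)) ∘ fun x => -x) t).prod * e

open Polynomial in
theorem pm_p3_boxProd_tree_aux {V : Type*} [Fintype V] [DecidableEq V]
    (T : SimpleGraph V) [DecidableRel T.Adj] (hT : T.IsTree)
    (hM : ∃ M : T.Subgraph, M.IsPerfectMatching) :
    (Pm (pathGraph 3 □ T) : ℝ) =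
      ((((T.adjMatrix ℝ).charpoly.roots).filter (fun α => 0 < α)).map
        (fun α => 2 + α ^ 2)).prod := by
  classical
  obtain ⟨N, hN, hN0⟩ : ∃ N : V → V, IsInv T N ∧ ∀ v, N v ≠ v := by
    obtain ⟨M, hM⟩ := hM
    choose f hf using (Subgraph.isPerfectMatching_iff).1 hM
    refine ⟨f, fun v => ⟨((hf (f v)).2 v (hf v).1.symm).symm, fun _ => M.adj_sub (hf v).1⟩,
      fun v => (M.adj_sub (hf v).1).ne'⟩
  have hA := hT.isAcyclic
  set fx : (V → V) → ℕ := fun M => (Finset.univ.filter (fun v => M v = v)).card with hfx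
  have hev : ∀ M, IsInv T M → Even (fx M) := fun M hM' =>
    (even_iff_two_dvd).2 ⟨_, (symGraph_card hA hM' hN hN0).symm⟩
  have hid : IsInv T id := fun v => ⟨rfl, fun h => (h rfl).elim⟩
  have hn : Even (Fintype.card V) := by simpa [hfx] using hev id hid
  have hle : ∀ M, fx M ≤ Fintype.card V := fun M => Finset.card_le_univ _
  have hexp := charpoly_expand (T := T) hA (fun M hM' => by
    have := hev M hM'
    exact (Nat.even_sub (hle M)).2 (by simp [hn, this]))
  change _ = ∑ M ∈ Finset.univ.filter (IsInv T), (-1) ^ ((Fintype.card V - fx M) / 2) *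
    X ^ fx M at hexp
  set p := (T.adjMatrix ℝ).charpoly with hp
  have hmonic : p.Monic := Matrix.charpoly_monic _
  have hH : (T.adjMatrix ℝ).IsHermitian := by
    rw [Matrix.IsHermitian, Matrix.conjTranspose_eq_transpose_of_trivial, transpose_adjMatrix]
  have hsplit : p.Splits := hH.splits_charpoly
  have hcomp : p.comp (-X) = p := by
    rw [hexp]
    simp only [Polynomial.sum_comp, mul_comp, pow_comp, X_comp, neg_comp, one_comp]
    refine Finset.sum_congr rfl (fun M hM' => ?_)
    rw [(hev M (Finset.mem_filter.1 hM').2).neg_pow]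
  have hneg : p.roots.map (fun x => -x) = p.roots := by
    rw [← roots_comp_neg_X, hcomp]
  have h0 : (0 : ℝ) ∉ p.roots := by
    intro h
    have hr : p.eval 0 = 0 := (mem_roots'.1 h).2
    rw [hexp] at hr
    simp only [eval_finsetSum, eval_mul, eval_pow, eval_X, eval_neg, eval_one] at hr
    have hr2 : ∑ M ∈ Finset.univ.filter (IsInv T),
        (-1 : ℝ) ^ (Fintype.card V / 2) * (if fx M = 0 then 1 else 0) = 0 := by
      refine Eq.trans ?_ hr
      refine Finset.sum_congr rfl (fun M _ => ?_)
      split_ifs with h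
      · simp [h]
      · simp [h]
    rw [← Finset.mul_sum, Finset.sum_boole] at hr2
    have hcard : (((Finset.univ.filter (IsInv T)).filter (fun M => fx M = 0)).card : ℝ) = 0 := by
      rcases mul_eq_zero.1 hr2 with h | h
      · exact absurd h (pow_ne_zero _ (by norm_num))
      · exact h
    have hcard' : ((Finset.univ.filter (IsInv T)).filter (fun M => fx M = 0)).card = 0 := by
      exact_mod_cast hcard
    rw [Finset.card_eq_zero] at hcard'
    have : N ∈ (Finset.univ.filter (IsInv T)).filter (fun M => fx M = 0) := by
      simp [hfx, hN, hN0]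
    rw [hcard'] at this
    simp at this
  have hcard : p.roots.card = Fintype.card V := by
    rw [splits_iff_card_roots.1 hsplit, hp, Matrix.charpoly_natDegree_eq_dim]
  obtain ⟨c, hc⟩ : ∃ c : ℂ, c ^ 2 = -2 := IsAlgClosed.exists_pow_nat_eq (-2 : ℂ) (by norm_num)
  have key := prod_pos_roots p.roots hneg h0 c hc
  have hl : aeval c p = (p.roots.map (fun α : ℝ => c - (α : ℂ))).prod := by
    conv_lhs => rw [hsplit.eq_prod_roots_of_monic hmonic]
    rw [map_multiset_prod, Multiset.map_map]
    simp [Function.comp_def]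
  rw [← hl, hcard] at key
  have hr : aeval c p =
      (-1) ^ (Fintype.card V / 2) * (Pm (pathGraph 3 □ T) : ℂ) := by
    rw [hexp, Pm_sum hA hN hN0, map_sum]
    push_cast
    rw [Finset.mul_sum]
    refine Finset.sum_congr rfl (fun M hM' => ?_)
    obtain ⟨k, hk⟩ := hev M (Finset.mem_filter.1 hM').2
    obtain ⟨m, hm⟩ := hn
    have hkm := hle M
    change _ = _ * 2 ^ (fx M / 2)
    simp only [map_mul, map_pow, map_neg, map_one, aeval_X]
    rw [hk, hm] at *
    have e1 : (m + m - (k + k)) / 2 = m - k := by omega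
    have e2 : (m + m) / 2 = (m - k) + k := by omega
    have e3 : (k + k) / 2 = k := by omega
    rw [e1, e2, e3, ← two_mul, pow_mul, hc, pow_add, mul_assoc, ← mul_pow]
    norm_num
  rw [hr] at key
  have := mul_left_cancel₀ (pow_ne_zero _ (by norm_num)) key
  exact_mod_cast this

/-- For a tree `T` with a perfect matching, `Pm(P_3 × T) = ∏ (2 + α²)`, the
product ranging over all positive eigenvalues `α` (with multiplicity) of `T`. -/
theorem pm_p3_boxProd_tree {V : Type*} [Fintype V] [DecidableEq V]
    (T : SimpleGraph V) [DecidableRel T.Adj] (hT : T.IsTree)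
    (hM : ∃ M : T.Subgraph, M.IsPerfectMatching) :
    (Pm (pathGraph 3 □ T) : ℝ) =
      ((((T.adjMatrix ℝ).charpoly.roots).filter (fun α => 0 < α)).map
        (fun α => 2 + α ^ 2)).prod := by
  exact pm_p3_boxProd_tree_aux T hT hM
end
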